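/- arXiv:2511.02316 — 5 statements merged into one kernel-verified Lean document; each statement's English description precedes it below -/
import Mathlib

section
/- For every z ∈ ℤ and every integer k > 0: if z < 0 then P(ξ(z,∞) = k) = h^{-z} (2q)^{k-1} (1 - 2q); if z = 0 then P(ξ(0,∞) = k) = (2q)^k (1 - 2q); and if z > 0 then P(ξ(z,∞) = k) = (2q)^{k-1} (1 - 2q). -/
open MeasureTheory ProbabilityTheory Filter Set
open scoped ENNReal NNReal

variable {Ω : Type*}

/-- Partial sums of the steps: `S X n = X 0 + ⋯ + X (n-1)` (the walk started at `0`). -/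
noncomputable def S (X : ℕ → Ω → ℤ) (n : ℕ) (ω : Ω) : ℤ :=
  ∑ i ∈ Finset.range n, X i ω

/-- The local time at site `z` up to time `n`: `ξ(z,n) = #{k : 0 < k ≤ n, S_k = z}`. -/
noncomputable def localTime (X : ℕ → Ω → ℤ) (z : ℤ) (n : ℕ) (ω : Ω) : ℕ :=
  ((Finset.Icc 1 n).filter (fun k => S X k ω = z)).card

/-- The maximal local time `ξ(n) = max_{y ∈ ℤ} ξ(y,n)`. -/
noncomputable def maxLocalTime (X : ℕ → Ω → ℤ) (n : ℕ) (ω : Ω) : ℕ :=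
  sSup (Set.range fun z : ℤ => localTime X z n ω)

/-- The set of favorite sites at time `n`: `K(n) = {z : ξ(z,n) = ξ(n)}`. -/
noncomputable def favSites (X : ℕ → Ω → ℤ) (n : ℕ) (ω : Ω) : Set ℤ :=
  {z : ℤ | localTime X z n ω = maxLocalTime X n ω}

/-- The total local time at site `z`: `ξ(z,∞) = #{k > 0 : S_k = z}` (as an extended natural). -/
noncomputable def totalLocalTime (X : ℕ → Ω → ℤ) (z : ℤ) (ω : Ω) : ℕ∞ :=
  {k : ℕ | 0 < k ∧ S X k ω = z}.encard

/-- `X` is a sequence of i.i.d. steps with `P(X_i = 1) = p`, `P(X_i = -1) = q`. -/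
def IsAsymmetricSRW [MeasurableSpace Ω] (P : Measure Ω) (X : ℕ → Ω → ℤ) (p q : ℝ) : Prop :=
  (∀ i, Measurable (X i)) ∧
  iIndepFun X P ∧
  (∀ i, P {ω | X i ω = 1} = ENNReal.ofReal p) ∧
  (∀ i, P {ω | X i ω = -1} = ENNReal.ofReal q)

namespace SRWaux

def cons (a : ℤ) (x : ℕ → ℤ) : ℕ → ℤ
  | 0 => a
  | n + 1 => x n

def T (n : ℕ) (x : ℕ → ℤ) : ℤ := ∑ i ∈ Finset.range n, x i

lemma T_cons (n : ℕ) (a : ℤ) (x : ℕ → ℤ) : T (n+1) (cons a x) = a + T n x := by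
  simp [T, Finset.sum_range_succ', cons, add_comm]

lemma T_zero (x : ℕ → ℤ) : T 0 x = 0 := by simp [T]

@[fun_prop]
lemma measurable_T (n : ℕ) : Measurable (T n) := by
  unfold T; fun_prop

lemma measurable_cons_uncurry : Measurable (fun y : ℤ × (ℕ → ℤ) => cons y.1 y.2) := by
  rw [measurable_pi_iff]
  intro n
  cases n with
  | zero => exact measurable_fst
  | succ n => exact (measurable_pi_apply n).comp measurable_snd

lemma measurable_cons (a : ℤ) : Measurable (cons a) :=
  measurable_cons_uncurry.comp measurable_prodMk_left

noncomputable def N (z : ℤ) (x : ℕ → ℤ) : ℕ∞ := {k : ℕ | T k x = z}.encard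
noncomputable def L (z : ℤ) (x : ℕ → ℤ) : ℕ∞ := {k : ℕ | 0 < k ∧ T k x = z}.encard

lemma L_cons (z a : ℤ) (x : ℕ → ℤ) : L z (cons a x) = N (z - a) x := by
  have : {k : ℕ | 0 < k ∧ T k (cons a x) = z} = Nat.succ '' {k : ℕ | T k x = z - a} := by
    ext k
    cases k with
    | zero => simp
    | succ k => simp [T_cons]; grind
  rw [L, this, Function.Injective.encard_image Nat.succ_injective, N]

lemma N_ne {z : ℤ} (hz : z ≠ 0) (x : ℕ → ℤ) : N z x = L z x := by
  have : {k : ℕ | 0 < k ∧ T k x = z} = {k : ℕ | T k x = z} := by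
    ext k
    cases k with
    | zero => simp [T_zero, hz.symm]
    | succ k => simp
  rw [L, this, N]

lemma N_zero (x : ℕ → ℤ) : N 0 x = L 0 x + 1 := by
  have : {k : ℕ | T k x = 0} = insert 0 {k : ℕ | 0 < k ∧ T k x = 0} := by
    ext k
    cases k with
    | zero => simp [T_zero]
    | succ k => simp
  rw [L, N, this, encard_insert_of_notMem (by simp)]

lemma measurableSet_encard (A : ℕ → Set (ℕ → ℤ)) (hA : ∀ n, MeasurableSet (A n)) (k : ℕ) :
    MeasurableSet {x | {n : ℕ | x ∈ A n}.encard = (k : ℕ∞)} := by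
  have key : ∀ k : ℕ, MeasurableSet {x | (k : ℕ∞) ≤ {n : ℕ | x ∈ A n}.encard} := by
    intro k
    have : {x | (k : ℕ∞) ≤ {n : ℕ | x ∈ A n}.encard}
        = ⋃ s : Finset ℕ, ⋃ (_ : s.card = k), ⋂ n ∈ s, A n := by
      ext x
      simp only [mem_setOf_eq, mem_iUnion, mem_iInter, exists_prop]
      constructor
      · intro h
        obtain ⟨t, ht, hc⟩ := exists_subset_encard_eq h
        have hf : t.Finite := finite_of_encard_eq_coe hc
        refine ⟨hf.toFinset, ?_, fun n hn => ht (by simpa using hn)⟩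
        rw [hf.encard_eq_coe_toFinset_card] at hc
        exact_mod_cast hc
      · rintro ⟨s, rfl, h⟩
        rw [← encard_coe_eq_coe_finsetCard]
        exact encard_le_encard (fun n hn => h n (by simpa using hn))
    rw [this]
    exact .iUnion fun s => .iUnion fun _ => Finset.measurableSet_biInter _ fun n _ => hA n
  have : {x | {n : ℕ | x ∈ A n}.encard = (k : ℕ∞)}
      = {x | (k : ℕ∞) ≤ {n : ℕ | x ∈ A n}.encard} \
        {x | ((k + 1 : ℕ) : ℕ∞) ≤ {n : ℕ | x ∈ A n}.encard} := by
    ext x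
    simp only [mem_setOf_eq, mem_diff, not_le]
    generalize {n : ℕ | x ∈ A n}.encard = e
    cases e with
    | top => simp
    | coe e => norm_cast; omega
  rw [this]
  exact (key k).diff (key (k+1))

lemma measurableSet_N (z : ℤ) (k : ℕ) : MeasurableSet {x | N z x = (k : ℕ∞)} :=
  measurableSet_encard (fun n => {x | T n x = z})
    (fun n => measurable_T n (measurableSet_singleton z)) k

lemma measurableSet_L (z : ℤ) (k : ℕ) : MeasurableSet {x | L z x = (k : ℕ∞)} :=
  measurableSet_encard (fun n => {x | 0 < n ∧ T n x = z})
    (fun n => (MeasurableSet.const _).inter (measurable_T n (measurableSet_singleton z))) k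

lemma map_cons (ν : Measure ℤ) [IsProbabilityMeasure ν] :
    (ν.prod (Measure.infinitePi fun _ : ℕ => ν)).map (fun y => cons y.1 y.2)
      = Measure.infinitePi fun _ : ℕ => ν := by
  classical
  apply Measure.eq_infinitePi
  intro s t ht
  obtain ⟨n, hn⟩ : ∃ n, s ⊆ Finset.range (n+1) := by
    obtain ⟨n, hn⟩ := s.exists_nat_subset_range
    exact ⟨n, hn.trans (Finset.range_subset_range.2 (by omega))⟩
  set f : ℕ → Set ℤ := fun i => if i ∈ s then t i else univ with hf
  have hfm : ∀ i, MeasurableSet (f i) := fun i => by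
    simp only [hf]; split_ifs
    · exact ht i
    · exact .univ
  have h1 : ∏ i ∈ s, ν (t i) = ∏ i ∈ Finset.range (n+1), ν (f i) := by
    rw [← Finset.prod_subset hn]
    · exact Finset.prod_congr rfl fun i hi => by simp [hf, hi]
    · intro i _ hi; simp [hf, hi]
  rw [Measure.map_apply measurable_cons_uncurry (.pi s.countable_toSet fun i _ => ht i), h1,
    Finset.prod_range_succ']
  have h2 : (fun y : ℤ × (ℕ → ℤ) => cons y.1 y.2) ⁻¹' (Set.pi s t)
      = f 0 ×ˢ (Set.pi (Finset.range n) fun i => f (i+1)) := by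
    ext ⟨a, x⟩
    simp only [mem_preimage, Set.mem_pi, mem_prod, Finset.mem_coe, Finset.mem_range, hf]
    constructor
    · intro h
      refine ⟨?_, fun i hi => ?_⟩
      · split_ifs with h0
        · exact h 0 h0
        · trivial
      · split_ifs with h0
        · exact h (i+1) h0
        · trivial
    · rintro ⟨h0, h⟩ i hi
      have hin := hn hi
      rw [Finset.mem_range] at hin
      cases i with
      | zero => simpa [hi, cons] using h0
      | succ i => simpa [hi, cons] using h i (by omega)
  rw [h2, Measure.prod_prod, Measure.infinitePi_pi _ (fun i _ => hfm _), mul_comm]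

section
variable {μ : Measure (ℕ → ℤ)} {p q : ℝ}

/-- one-step decomposition -/
def Step (μ : Measure (ℕ → ℤ)) (p q : ℝ) : Prop := ∀ A : Set (ℕ → ℤ), MeasurableSet A →
  μ.real A = p * μ.real (cons 1 ⁻¹' A) + q * μ.real (cons (-1) ⁻¹' A)

lemma step_infinitePi (ν : Measure ℤ) [IsProbabilityMeasure ν] (hp : 0 ≤ p) (hq : 0 ≤ q)
    (hν : ν = ENNReal.ofReal p • Measure.dirac 1 + ENNReal.ofReal q • Measure.dirac (-1)) :
    Step (Measure.infinitePi fun _ : ℕ => ν) p q := by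
  intro A hA
  set μ := Measure.infinitePi fun _ : ℕ => ν with hμ
  have h : μ A = ENNReal.ofReal p * μ (cons 1 ⁻¹' A) + ENNReal.ofReal q * μ (cons (-1) ⁻¹' A) := by
    conv_lhs => rw [hμ, ← map_cons ν, Measure.map_apply measurable_cons_uncurry hA,
      Measure.prod_apply (measurable_cons_uncurry hA)]
    conv_lhs => rw [← hμ]
    conv_lhs => enter [1]; rw [hν]
    rw [lintegral_add_measure, lintegral_smul_measure, lintegral_smul_measure,
      lintegral_dirac, lintegral_dirac]
    rfl
  simp only [measureReal_def]
  rw [h, ENNReal.toReal_add (by finiteness) (by finiteness), ENNReal.toReal_mul,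
    ENNReal.toReal_mul, ENNReal.toReal_ofReal hp, ENNReal.toReal_ofReal hq]

variable [IsProbabilityMeasure μ]

lemma L_step (h : Step μ p q) (z : ℤ) (k : ℕ) :
    μ.real {x | L z x = (k : ℕ∞)} = p * μ.real {x | N (z-1) x = (k : ℕ∞)}
      + q * μ.real {x | N (z+1) x = (k : ℕ∞)} := by
  rw [h _ (measurableSet_L z k)]
  simp only [preimage_setOf_eq, L_cons, sub_neg_eq_add]

lemma hit_fin (h : Step μ p q) (hp : 0 < p) (hq : 0 < q) (hlt : q < p) (hpq : p + q = 1) (m : ℕ) :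
    ∀ z : ℤ, μ.real {x | ∃ j ≤ m, T j x = z} ≤ (q/p) ^ (-z) := by
  induction m with
  | zero =>
    intro z
    by_cases hz : z = 0
    · subst hz; simpa using measureReal_le_one
    · have : {x : ℕ → ℤ | ∃ j ≤ 0, T j x = z} = ∅ := by
        ext x; simp [T_zero, Ne.symm hz]
      rw [this]; simp; positivity
  | succ m ih =>
    intro z
    by_cases hz : z = 0
    · subst hz; simpa using measureReal_le_one
    have hm : MeasurableSet {x | ∃ j ≤ m + 1, T j x = z} := by
      have : {x | ∃ j ≤ m + 1, T j x = z} = ⋃ j, ⋃ (_ : j ≤ m + 1), {x | T j x = z} := by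
        ext x; simp
      rw [this]
      exact .iUnion fun j => .iUnion fun _ => measurable_T j (measurableSet_singleton z)
    have hsub : ∀ a : ℤ, μ.real (cons a ⁻¹' {x | ∃ j ≤ m + 1, T j x = z}) ≤ (q/p) ^ (-(z-a)) := by
      intro a
      refine le_trans (measureReal_mono ?_) (ih (z - a))
      rintro x ⟨j, hj, hx⟩
      cases j with
      | zero => exact absurd (by simpa [T_zero] using hx.symm) hz
      | succ j => rw [T_cons] at hx; exact ⟨j, by omega, by omega⟩
    rw [h _ hm]
    calc _ ≤ p * (q/p) ^ (-(z-1)) + q * (q/p) ^ (-(z- -1)) := by gcongr <;> exact hsub _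
      _ = (q/p) ^ (-z) := by
        have h0 : q / p ≠ 0 := by positivity
        rw [show -(z-1) = -z + 1 by ring, show -(z - -1) = -z - 1 by ring, zpow_add₀ h0,
          zpow_sub₀ h0, zpow_one]
        field_simp
        linarith

lemma hit (h : Step μ p q) (hp : 0 < p) (hq : 0 < q) (hlt : q < p) (hpq : p + q = 1) (n : ℕ) :
    μ.real {x | ∃ j, T j x = -(n : ℤ)} ≤ (q/p) ^ n := by
  have h1 : {x | ∃ j, T j x = -(n : ℤ)} = ⋃ m : ℕ, {x | ∃ j ≤ m, T j x = -(n : ℤ)} := by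
    ext x; simp only [mem_setOf_eq, mem_iUnion]
    exact ⟨fun ⟨j, hj⟩ => ⟨j, j, le_rfl, hj⟩, fun ⟨_, j, _, hj⟩ => ⟨j, hj⟩⟩
  have hmono : Monotone fun m : ℕ => {x | ∃ j ≤ m, T j x = -(n : ℤ)} :=
    fun a b hab x ⟨j, hj, hx⟩ => ⟨j, hj.trans hab, hx⟩
  have ht := tendsto_measure_iUnion_atTop (μ := μ) hmono
  rw [← h1] at ht
  have ht' := (ENNReal.tendsto_toReal (measure_ne_top μ _)).comp ht
  refine le_of_tendsto' ht' fun m => ?_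
  have := hit_fin h hp hq hlt hpq m (-(n:ℤ))
  rw [neg_neg, zpow_natCast] at this
  exact this

lemma pos_const {g : ℤ → ℝ} (hp : 0 < p) (hq : 0 < q) (hlt : q < p) (hpq : p + q = 1)
    (h0 : ∀ z, 0 ≤ g z) (h1 : ∀ z, g z ≤ 1)
    (hg : ∀ z, z ≠ 0 → g z = p * g (z-1) + q * g (z+1)) (n : ℕ) : g n = g 0 := by
  have hd : ∀ n : ℕ, g (n+1) - g n = (p/q)^n * (g 1 - g 0) := by
    intro n
    induction n with
    | zero => simp
    | succ n ih =>
      have := hg (n+1) (by omega)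
      rw [pow_succ, mul_right_comm, ← ih]
      push_cast
      rw [show (n : ℤ) + 1 - 1 = n by ring] at this
      field_simp
      have e : p = 1 - q := by linarith
      subst e
      linarith
  have hd0 : g 1 - g 0 = 0 := by
    by_contra hne
    have ht := tendsto_pow_atTop_atTop_of_one_lt ((one_lt_div hq).2 hlt)
    obtain ⟨n, hn⟩ := (ht.eventually_gt_atTop (1 / |g 1 - g 0|)).exists
    have hpos : 0 < |g 1 - g 0| := abs_pos.2 hne
    rw [div_lt_iff₀ hpos] at hn
    have : |g (n+1) - g n| = (p/q)^n * |g 1 - g 0| := by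
      rw [hd, abs_mul, abs_of_pos (by positivity)]
    have h2 : |g (n+1) - g n| ≤ 1 := by
      rw [abs_le]; constructor <;> linarith [h0 (n+1), h0 n, h1 (n+1), h1 n]
    linarith
  induction n with
  | zero => simp
  | succ n ih => have := hd n; rw [hd0, mul_zero] at this; push_cast; linarith

lemma neg_rel {g : ℤ → ℝ} {l : ℝ} (hpq : p + q = 1)
    (hg : ∀ z, z ≠ 0 → g z = p * g (z-1) + q * g (z+1))
    (hl : Tendsto (fun n : ℕ => g (-(n : ℤ))) atTop (nhds l)) (n : ℕ) :
    p * g (-(n+1 : ℤ)) = q * g (-(n : ℤ)) + (p - q) * l := by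
  have hc : ∀ n : ℕ, p * g (-(n+1 : ℤ)) - q * g (-(n : ℤ)) = p * g (-1) - q * g 0 := by
    intro n
    induction n with
    | zero => simp
    | succ n ih =>
      rw [← ih]
      have := hg (-(n+1 : ℤ)) (by omega)
      rw [show -(n+1 : ℤ) - 1 = -(n+1+1 : ℤ) by ring, show -(n+1 : ℤ) + 1 = -(n:ℤ) by ring] at this
      push_cast
      have e : p = 1 - q := by linarith
      subst e
      linarith
  have hl' : Tendsto (fun n : ℕ => g (-(n + 1 : ℤ))) atTop (nhds l) := by
    have := hl.comp (tendsto_add_atTop_nat 1)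
    simpa [Function.comp_def] using this
  have ht := (hl'.const_mul p).sub (hl.const_mul q)
  simp only [hc] at ht
  have := tendsto_nhds_unique ht tendsto_const_nhds
  have := hc n
  linarith

theorem main (h : Step μ p q) (hp : 0 < p) (hq : 0 < q) (hlt : q < p) (hpq : p + q = 1)
    (z : ℤ) (k : ℕ) (hk : 0 < k) :
    (z < 0 → μ.real {x | L z x = (k : ℕ∞)} = (q/p) ^ (-z) * (2*q) ^ (k - 1) * (1 - 2*q)) ∧
    (z = 0 → μ.real {x | L z x = (k : ℕ∞)} = (2*q) ^ k * (1 - 2*q)) ∧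
    (0 < z → μ.real {x | L z x = (k : ℕ∞)} = (2*q) ^ (k - 1) * (1 - 2*q)) := by
  set g : ℕ → ℤ → ℝ := fun k z => μ.real {x | N z x = (k : ℕ∞)} with hgdef
  have g0 : ∀ k z, 0 ≤ g k z := fun k z => measureReal_nonneg
  have g1 : ∀ k z, g k z ≤ 1 := fun k z => measureReal_le_one
  have hL : ∀ (k : ℕ) z, μ.real {x | L z x = (k : ℕ∞)} = p * g k (z-1) + q * g k (z+1) :=
    fun k z => L_step h z k
  have hgL : ∀ (k : ℕ) z, z ≠ 0 → g k z = μ.real {x | L z x = (k : ℕ∞)} := by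
    intro k z hz; simp only [hgdef, N_ne hz]
  have hg : ∀ k z, z ≠ 0 → g k z = p * g k (z-1) + q * g k (z+1) := by
    intro k z hz; rw [hgL k z hz, hL]
  have hG0 : g 0 0 = 0 := by simp [hgdef, N_zero]
  have hGs : ∀ k, g (k+1) 0 = μ.real {x | L 0 x = (k : ℕ∞)} := by
    intro k
    simp only [hgdef, N_zero]
    congr 1
    ext x
    simp only [mem_setOf_eq]
    generalize L 0 x = e
    cases e with
    | top => exact ⟨fun h => absurd h (by simpa using (ENat.coe_ne_top (k+1)).symm), fun h => absurd h (by simp)⟩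
    | coe e => norm_cast; omega
  have hpow : Tendsto (fun n : ℕ => (q/p)^n) atTop (nhds 0) :=
    tendsto_pow_atTop_nhds_zero_of_lt_one (by positivity) ((div_lt_one hp).2 hlt)
  have hlim : ∀ k, 0 < k → Tendsto (fun n : ℕ => g k (-(n : ℤ))) atTop (nhds 0) := by
    intro k hk
    refine squeeze_zero (fun n => g0 _ _) (fun n => ?_) hpow
    refine le_trans (measureReal_mono ?_) (hit h hp hq hlt hpq n)
    intro x hx
    by_contra hne
    simp only [mem_setOf_eq, not_exists] at hne hx
    have : {k : ℕ | T k x = -(n:ℤ)} = ∅ := by ext j; simp [hne j]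
    rw [N, this, encard_empty] at hx
    exact hk.ne (by exact_mod_cast hx)
  have hlim0 : Tendsto (fun n : ℕ => g 0 (-(n : ℤ))) atTop (nhds 1) := by
    have hlow : Tendsto (fun n : ℕ => 1 - (q/p)^n) atTop (nhds 1) := by
      simpa using hpow.const_sub 1
    refine tendsto_of_tendsto_of_tendsto_of_le_of_le hlow tendsto_const_nhds (fun n => ?_)
      (fun n => g1 _ _)
    have h2 := hit h hp hq hlt hpq n
    have h3 : {x | ∃ j, T j x = -(n : ℤ)} = {x | N (-(n:ℤ)) x = ((0 : ℕ) : ℕ∞)}ᶜ := by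
      ext x
      simp [N, Set.eq_empty_iff_forall_notMem]
    rw [h3, probReal_compl_eq_one_sub (measurableSet_N _ _)] at h2
    simp only [hgdef]
    linarith
  have hpos : ∀ k (n : ℕ), g k n = g k 0 := fun k n =>
    pos_const hp hq hlt hpq (g0 k) (g1 k) (hg k) n
  have hneg : ∀ k, 0 < k → ∀ n : ℕ, g k (-(n : ℤ)) = (q/p)^n * g k 0 := by
    intro k hk n
    induction n with
    | zero => simp
    | succ n ih =>
      have := neg_rel hpq (hg k) (hlim k hk) n
      push_cast
      rw [pow_succ, mul_right_comm, ← ih]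
      field_simp
      linarith
  have hG1 : g 1 0 = 1 - 2*q := by
    have e1 := hGs 0
    rw [hL] at e1
    have e2 := neg_rel hpq (hg 0) hlim0 0
    have e3 := hpos 0 1
    simp only [zero_add, Nat.cast_zero, Nat.cast_one, neg_zero, zero_sub] at e1 e2 e3
    rw [e1, e2, e3, hG0]
    linarith
  have hrec : ∀ k : ℕ, 0 < k → μ.real {x | L 0 x = (k : ℕ∞)} = 2*q * g k 0 := by
    intro k hk
    rw [hL]
    have e2 := hneg k hk 1
    have e3 := hpos k 1
    simp only [zero_add, Nat.cast_one, zero_sub, pow_one] at e2 e3 ⊢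
    rw [e2, e3]; field_simp; ring
  have hG : ∀ k, g (k+1) 0 = (2*q)^k * (1 - 2*q) := by
    intro k
    induction k with
    | zero => simpa using hG1
    | succ k ih => rw [hGs, hrec _ (by omega), ih]; ring
  obtain ⟨k, rfl⟩ : ∃ j, k = j + 1 := ⟨k - 1, by omega⟩
  refine ⟨fun hz => ?_, fun hz => ?_, fun hz => ?_⟩
  · rw [← hgL _ _ hz.ne]
    obtain ⟨n, rfl⟩ : ∃ n : ℕ, z = -(n : ℤ) := ⟨z.natAbs, by omega⟩
    rw [hneg _ hk, hG]
    simp [mul_assoc]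
  · subst hz
    rw [hrec _ hk, hG]; ring
  · rw [← hgL _ _ hz.ne']
    obtain ⟨n, rfl⟩ : ∃ n : ℕ, z = (n : ℤ) := ⟨z.natAbs, by omega⟩
    rw [hpos, hG]; simp

end

lemma law_eq [MeasurableSpace Ω] (P : Measure Ω) [IsProbabilityMeasure P]
    (Y : Ω → ℤ) (hY : Measurable Y) (p q : ℝ) (hp : 0 ≤ p) (hq : 0 ≤ q) (hpq : p + q = 1)
    (h1 : P {ω | Y ω = 1} = ENNReal.ofReal p) (h2 : P {ω | Y ω = -1} = ENNReal.ofReal q) :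
    P.map Y = ENNReal.ofReal p • Measure.dirac 1 + ENNReal.ofReal q • Measure.dirac (-1) := by
  have := Measure.isProbabilityMeasure_map (μ := P) hY.aemeasurable
  have a1 : P.map Y {1} = ENNReal.ofReal p := by
    rw [Measure.map_apply hY (measurableSet_singleton _)]; exact h1
  have a2 : P.map Y {-1} = ENNReal.ofReal q := by
    rw [Measure.map_apply hY (measurableSet_singleton _)]; exact h2
  have a3 : P.map Y ({1, -1}ᶜ : Set ℤ) = 0 := by
    rw [prob_compl_eq_zero_iff (by measurability), Set.insert_eq,
      measure_union (by simp) (measurableSet_singleton _), a1, a2,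
      ← ENNReal.ofReal_add hp hq, hpq, ENNReal.ofReal_one]
  refine Measure.ext_of_singleton fun z => ?_
  by_cases hz1 : z = 1
  · subst hz1; simp [a1]
  by_cases hz2 : z = -1
  · subst hz2; simp [a2]
  have : P.map Y {z} = 0 := measure_mono_null (by simp [hz1, hz2]) a3
  rw [this]
  simp [Ne.symm hz1, Ne.symm hz2]

end SRWaux

/-- The distribution of the total local time `ξ(z,∞)`: for `k > 0`,
`P(ξ(z,∞)=k)` equals `h^{-z}(2q)^{k-1}(1-2q)` if `z < 0`, `(2q)^k (1-2q)` if `z = 0`,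
and `(2q)^{k-1}(1-2q)` if `z > 0`, where `h = q/p`. -/
theorem total_local_time_distribution
    [MeasurableSpace Ω] (P : Measure Ω) [IsProbabilityMeasure P]
    (X : ℕ → Ω → ℤ) (p q : ℝ) (hq0 : 0 < q) (hq : q < 1/2) (hpq : p + q = 1)
    (hX : IsAsymmetricSRW P X p q) (z : ℤ) (k : ℕ) (hk : 0 < k) :
    (z < 0 → P {ω | totalLocalTime X z ω = (k : ℕ∞)}
        = ENNReal.ofReal ((q/p) ^ (-z) * (2*q) ^ (k - 1) * (1 - 2*q))) ∧
    (z = 0 → P {ω | totalLocalTime X z ω = (k : ℕ∞)}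
        = ENNReal.ofReal ((2*q) ^ k * (1 - 2*q))) ∧
    (0 < z → P {ω | totalLocalTime X z ω = (k : ℕ∞)}
        = ENNReal.ofReal ((2*q) ^ (k - 1) * (1 - 2*q))) := by
  obtain ⟨hm, hind, h1, h2⟩ := hX
  have hp : 0 < p := by linarith
  have hlt : q < p := by linarith
  set ν : Measure ℤ := P.map (X 0) with hν
  have : IsProbabilityMeasure ν := Measure.isProbabilityMeasure_map (hm 0).aemeasurable
  have hlaw : ∀ i, P.map (X i) = ν := fun i => by
    rw [hν, SRWaux.law_eq P (X i) (hm i) p q hp.le hq0.le hpq (h1 i) (h2 i),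
      SRWaux.law_eq P (X 0) (hm 0) p q hp.le hq0.le hpq (h1 0) (h2 0)]
  have hmap : P.map (fun ω i => X i ω) = Measure.infinitePi fun _ : ℕ => ν := by
    rw [hind.map_fun_eq_infinitePi_map₀ (by fun_prop)]
    simp only [hlaw]
  have hstep := SRWaux.step_infinitePi (p := p) (q := q) ν hp.le hq0.le
    (SRWaux.law_eq P (X 0) (hm 0) p q hp.le hq0.le hpq (h1 0) (h2 0))
  have hmain := SRWaux.main hstep hp hq0 hlt hpq z k hk
  have hP : P {ω | totalLocalTime X z ω = (k : ℕ∞)}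
      = ENNReal.ofReal ((Measure.infinitePi fun _ : ℕ => ν).real {x | SRWaux.L z x = (k : ℕ∞)}) := by
    rw [ofReal_measureReal, ← hmap, Measure.map_apply (by fun_prop) (SRWaux.measurableSet_L z k)]
    rfl
  rw [hP]
  exact ⟨fun h => by rw [hmain.1 h], fun h => by rw [hmain.2.1 h], fun h => by rw [hmain.2.2 h]⟩
end

section
/- Almost surely, lim_{n→∞} ξ(n) / log n = λ, where λ = -1/log(2q). -/
open MeasureTheory ProbabilityTheory Filter Set
open scoped ENNReal NNReal

variable {Ω : Type*}

/-- visits to `0` in steps `1..n` of the walk from `x` with steps `w` -/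
def wcnt (n : ℕ) (w : ℕ → ℤ) (x : ℤ) : ℕ :=
  ∑ i ∈ Finset.range n, if x + ∑ l ∈ Finset.range (i+1), w l = 0 then 1 else 0

lemma wcnt_succ (n : ℕ) (w : ℕ → ℤ) (x : ℤ) :
    wcnt (n+1) w x = (if x + w 0 = 0 then 1 else 0) + wcnt n (fun i => w (i+1)) (x + w 0) := by
  unfold wcnt
  rw [Finset.sum_range_succ', add_comm]
  congr 1
  · simp
  · apply Finset.sum_congr rfl
    intro i _
    rw [Finset.sum_range_succ' _ (i+1)]
    congr 2
    ring

lemma wcnt_congr (n : ℕ) (w w' : ℕ → ℤ) (x : ℤ) (h : ∀ i < n, w i = w' i) :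
    wcnt n w x = wcnt n w' x := by
  unfold wcnt
  apply Finset.sum_congr rfl
  intro i hi
  have : ∑ l ∈ Finset.range (i+1), w l = ∑ l ∈ Finset.range (i+1), w' l := by
    apply Finset.sum_congr rfl
    intro l hl
    apply h
    simp at hi hl
    omega
  rw [this]

lemma wcnt_card (n : ℕ) (w : ℕ → ℤ) (x : ℤ) :
    wcnt n w x = ((Finset.range n).filter
      (fun i => x + ∑ l ∈ Finset.range (i+1), w l = 0)).card := by
  unfold wcnt
  rw [Finset.card_filter]

lemma wcnt_mono {n m : ℕ} (h : n ≤ m) (w : ℕ → ℤ) (x : ℤ) : wcnt n w x ≤ wcnt m w x := by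
  unfold wcnt
  apply Finset.sum_le_sum_of_subset
  intro i; simp; omega

lemma S_add (X : ℕ → Ω → ℤ) (j i : ℕ) (ω : Ω) :
    S X (j + i) ω = S X j ω + ∑ l ∈ Finset.range i, X (j + l) ω := by
  unfold S
  rw [Finset.sum_range_add]

lemma localTime_le (X : ℕ → Ω → ℤ) (z : ℤ) (n : ℕ) (ω : Ω) : localTime X z n ω ≤ n := by
  unfold localTime
  refine (Finset.card_filter_le _ _).trans ?_
  simp

lemma bdd_localTime (X : ℕ → Ω → ℤ) (n : ℕ) (ω : Ω) :
    BddAbove (Set.range fun z : ℤ => localTime X z n ω) :=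
  ⟨n, by rintro _ ⟨z, rfl⟩; exact localTime_le X z n ω⟩

lemma le_maxLocalTime (X : ℕ → Ω → ℤ) (z : ℤ) (n : ℕ) (ω : Ω) :
    localTime X z n ω ≤ maxLocalTime X n ω :=
  le_csSup (bdd_localTime X n ω) ⟨z, rfl⟩

lemma exists_maxLocalTime (X : ℕ → Ω → ℤ) (n : ℕ) (ω : Ω) :
    ∃ z, localTime X z n ω = maxLocalTime X n ω :=
  Nat.sSup_mem (Set.range_nonempty _) (bdd_localTime X n ω)

lemma maxLocalTime_mono (X : ℕ → Ω → ℤ) {n m : ℕ} (h : n ≤ m) (ω : Ω) :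
    maxLocalTime X n ω ≤ maxLocalTime X m ω := by
  obtain ⟨z, hz⟩ := exists_maxLocalTime X n ω
  rw [← hz]
  refine le_trans ?_ (le_maxLocalTime X z m ω)
  unfold localTime
  apply Finset.card_le_card
  apply Finset.filter_subset_filter
  exact Finset.Icc_subset_Icc le_rfl h

lemma wcnt_le_max (X : ℕ → Ω → ℤ) (j m n : ℕ) (h : j + m ≤ n) (ω : Ω) :
    wcnt m (fun i => X (j+i) ω) 0 ≤ maxLocalTime X n ω := by
  refine le_trans ?_ (le_maxLocalTime X (S X j ω) n ω)
  rw [wcnt_card]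
  unfold localTime
  apply Finset.card_le_card_of_injOn (fun i => j + (i + 1))
  · intro i hi
    simp only [Finset.coe_filter, Finset.mem_range, Set.mem_ofPred_eq, Finset.mem_Icc] at hi ⊢
    refine ⟨by omega, ?_⟩
    rw [S_add]
    have := hi.2
    simp only [zero_add] at this
    rw [this]; simp
  · intro a _ b _ hab
    simp at hab
    exact hab

lemma max_le_wcnt (X : ℕ → Ω → ℤ) (n k : ℕ) (ω : Ω) (h : k + 1 ≤ maxLocalTime X n ω) :
    ∃ j ∈ Finset.range (n+1), k ≤ wcnt n (fun i => X (j+i) ω) 0 := by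
  obtain ⟨z, hz⟩ := exists_maxLocalTime X n ω
  rw [← hz] at h
  unfold localTime at h
  set F := (Finset.Icc 1 n).filter (fun k => S X k ω = z) with hF
  have hne : F.Nonempty := by
    rw [← Finset.card_pos]; omega
  have hmin := Finset.min'_mem F hne
  set j := F.min' hne with hj
  have hlt : ∀ i ∈ F, j ≤ i := fun i hi => Finset.min'_le F i hi
  have hjz : S X j ω = z := by
    rw [hF, Finset.mem_filter] at hmin
    exact hmin.2
  have hjn : j ≤ n := by
    rw [hF, Finset.mem_filter, Finset.mem_Icc] at hmin
    exact hmin.1.2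
  refine ⟨j, by simp; omega, ?_⟩
  have hc : k ≤ (F.erase j).card := by
    rw [Finset.card_erase_of_mem hmin]; omega
  refine hc.trans ?_
  rw [wcnt_card]
  apply Finset.card_le_card_of_injOn (fun i => i - j - 1)
  · intro i hi
    rw [Finset.mem_coe, Finset.mem_erase] at hi
    have h1 := hlt i hi.2
    have h2 := hi.1
    have h3 := hi.2
    rw [hF, Finset.mem_filter, Finset.mem_Icc] at h3
    simp only [Finset.coe_filter, Finset.mem_range, Set.mem_ofPred_eq]
    refine ⟨by omega, ?_⟩
    have h4 : i - j - 1 + 1 = i - j := by omega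
    rw [h4]
    have h5 := S_add X j (i - j) ω
    rw [show j + (i - j) = i by omega, h3.2, hjz] at h5
    linarith
  · intro a ha b hb hab
    rw [Finset.mem_coe, Finset.mem_erase] at ha hb
    have h1 := hlt a ha.2
    have h2 := hlt b hb.2
    have := ha.1
    have := hb.1
    simp only at hab
    omega

/-- recursion for the law of `wcnt` -/
noncomputable def fR (p q : ℝ) : ℕ → ℕ → ℤ → ℝ
  | 0, k, _ => if k = 0 then 1 else 0
  | n+1, k, x => p * fR p q n (k - if x + 1 = 0 then 1 else 0) (x+1)
      + q * fR p q n (k - if x - 1 = 0 then 1 else 0) (x-1)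

section det
variable {p q : ℝ}

lemma fR_nonneg (hp : 0 ≤ p) (hq : 0 ≤ q) (n k : ℕ) (x : ℤ) : 0 ≤ fR p q n k x := by
  induction n generalizing k x with
  | zero => unfold fR; split_ifs <;> norm_num
  | succ n ih => unfold fR; have := ih; apply add_nonneg <;> apply mul_nonneg <;> simp [*]

lemma fR_zero (hpq : p + q = 1) (n : ℕ) (x : ℤ) : fR p q n 0 x = 1 := by
  induction n generalizing x with
  | zero => simp [fR]
  | succ n ih => unfold fR; simp [ih, hpq]

lemma fR_mono (hp : 0 ≤ p) (hq : 0 ≤ q) (hpq : p + q = 1) (n k : ℕ) (x : ℤ) :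
    fR p q n k x ≤ fR p q (n+1) k x := by
  induction n generalizing k x with
  | zero =>
    rcases Nat.eq_zero_or_pos k with rfl | hk
    · rw [fR_zero hpq, fR_zero hpq]
    · rw [fR, if_neg (by omega)]; exact fR_nonneg hp hq _ _ _
  | succ n ih =>
    rw [fR, fR.eq_def p q (n+1+1)]
    simp only
    gcongr <;> apply ih

lemma fR_mono' (hp : 0 ≤ p) (hq : 0 ≤ q) (hpq : p + q = 1) {n m : ℕ} (h : n ≤ m) (k : ℕ) (x : ℤ) :
    fR p q n k x ≤ fR p q m k x :=
  monotone_nat_of_le_succ (f := fun n => fR p q n k x) (fun n => fR_mono hp hq hpq n k x) h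

lemma fR_super (hp : 0 ≤ p) (hq : 0 ≤ q) (hpq : p + q = 1) (n m k : ℕ) (x : ℤ) :
    fR p q n 1 x * fR p q m k 0 ≤ fR p q (n+m) (k+1) x := by
  induction n generalizing x with
  | zero => simp [fR]; exact fR_nonneg hp hq _ _ _
  | succ n ih =>
    rw [show n + 1 + m = (n+m)+1 by ring, fR, fR.eq_def p q (n+m+1)]
    simp only
    have key : ∀ y : ℤ, fR p q n (1 - if y = 0 then 1 else 0) y * fR p q m k 0
        ≤ fR p q (n+m) (k + 1 - if y = 0 then 1 else 0) y := by
      intro y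
      by_cases hy : y = 0
      · subst hy
        simp [fR_zero hpq]
        exact fR_mono' hp hq hpq (by omega) _ _
      · simp [hy]; exact ih y
    have h1 := mul_le_mul_of_nonneg_left (key (x+1)) hp
    have h2 := mul_le_mul_of_nonneg_left (key (x-1)) hq
    nlinarith

lemma fR_pow (hp : 0 ≤ p) (hq : 0 ≤ q) (hpq : p + q = 1) (T k : ℕ) :
    fR p q T 1 0 ^ k ≤ fR p q (k * T) k 0 := by
  induction k with
  | zero => simp [fR]
  | succ k ih =>
    rw [pow_succ', show (k+1) * T = T + k * T by ring]
    exact le_trans (mul_le_mul_of_nonneg_left ih (fR_nonneg hp hq _ _ _))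
      (fR_super hp hq hpq T (k*T) k 0)

/-- hitting probability of zero -/
noncomputable def hR (p q : ℝ) (x : ℤ) : ℝ :=
  if x < 0 then 1 else if x = 0 then 2 * q else (q/p)^(x.toNat)

lemma hR_neg {x : ℤ} (h : x < 0) : hR p q x = 1 := by simp [hR, h]
lemma hR_zero : hR p q 0 = 2 * q := by simp [hR]
lemma hR_pos (m : ℕ) : hR p q ((m:ℤ)+1) = (q/p)^(m+1) := by
  have h1 : ¬ ((m:ℤ)+1 < 0) := by omega
  have h2 : ¬ ((m:ℤ)+1 = 0) := by omega
  have h3 : ((m:ℤ)+1).toNat = m+1 := by omega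
  simp only [hR, h1, h2, h3, if_false]

/-- hitting probability of zero, with value one at zero -/
noncomputable def hR' (p q : ℝ) (x : ℤ) : ℝ := if x = 0 then 1 else hR p q x

lemma hR_harm (hp : 0 < p) (hpq : p + q = 1) (x : ℤ) :
    p * hR' p q (x+1) + q * hR' p q (x-1) = hR p q x := by
  rcases lt_trichotomy x 0 with h | h | h
  · have h1 : hR' p q (x+1) = 1 := by
      unfold hR'
      split_ifs with h2
      · rfl
      · exact hR_neg (by omega)
    have h2 : hR' p q (x-1) = 1 := by
      unfold hR'
      rw [if_neg (by omega)]
      exact hR_neg (by omega)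
    rw [h1, h2, hR_neg h]; linarith
  · subst h
    have h1 : hR' p q (0+1) = q/p := by
      unfold hR'
      rw [if_neg (by omega)]
      simpa using hR_pos (p := p) (q := q) 0
    have h2 : hR' p q (0-1) = 1 := by
      unfold hR'
      rw [if_neg (by omega)]
      exact hR_neg (by omega)
    rw [h1, h2, hR_zero]; field_simp; ring
  · obtain ⟨m, rfl⟩ : ∃ m : ℕ, x = (m:ℤ) + 1 := ⟨(x-1).toNat, by omega⟩
    have h1 : hR' p q ((m:ℤ)+1+1) = (q/p)^(m+2) := by
      unfold hR'
      rw [if_neg (by omega)]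
      simpa using hR_pos (p := p) (q := q) (m+1)
    have h2 : hR' p q ((m:ℤ)+1-1) = (q/p)^m := by
      unfold hR'
      split_ifs with h2
      · have : m = 0 := by omega
        simp [this]
      · obtain ⟨l, rfl⟩ : ∃ l, m = l + 1 := ⟨m-1, by omega⟩
        simpa using hR_pos (p := p) (q := q) l
    rw [h1, h2, hR_pos]
    have : p * (q/p)^(m+2) = q * (q/p)^(m+1) := by
      rw [pow_succ _ (m+1)]; field_simp
    rw [this]
    have h3 : q * (q/p)^m = p * (q/p)^(m+1) := by
      rw [pow_succ _ m]; field_simp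
    rw [h3]
    rw [← add_mul, add_comm q p, hpq, one_mul]

lemma hR_nonneg (hp : 0 < p) (hq : 0 < q) (x : ℤ) : 0 ≤ hR p q x := by
  unfold hR; split_ifs <;> positivity

lemma fR_le (hp : 0 < p) (hq : 0 < q) (hpq : p + q = 1) (n k : ℕ) (x : ℤ) :
    fR p q n (k+1) x ≤ hR p q x * (2*q)^k := by
  induction n generalizing k x with
  | zero => simp [fR]; have := hR_nonneg hp hq x; positivity
  | succ n ih =>
    have key : ∀ y : ℤ, fR p q n (k + 1 - if y = 0 then 1 else 0) y ≤ hR' p q y * (2*q)^k := by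
      intro y
      by_cases hy : y = 0
      · subst hy
        simp only [if_true, hR', add_tsub_cancel_right, one_mul]
        cases k with
        | zero => simp [fR_zero hpq]
        | succ k =>
          refine (ih k 0).trans ?_
          rw [hR_zero, pow_succ']
      · simp only [hy, hR', if_false]; exact ih k y
    rw [fR, ← hR_harm hp hpq x, add_mul, mul_assoc, mul_assoc]
    have h1 := mul_le_mul_of_nonneg_left (key (x+1)) hp.le
    have h2 := mul_le_mul_of_nonneg_left (key (x-1)) hq.le
    linarith

lemma fR_le_pow (hp : 0 < p) (hq : 0 < q) (hpq : p + q = 1) (n k : ℕ) :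
    fR p q n k 0 ≤ (2*q)^k := by
  cases k with
  | zero => simp [fR_zero hpq]
  | succ k =>
    refine (fR_le hp hq hpq n k 0).trans ?_
    rw [hR_zero, pow_succ']

lemma fR_le_one (hp : 0 ≤ p) (hq : 0 ≤ q) (hpq : p + q = 1) (n k : ℕ) (x : ℤ) :
    fR p q n k x ≤ 1 := by
  induction n generalizing k x with
  | zero => unfold fR; split_ifs <;> norm_num
  | succ n ih =>
    rw [fR]
    have h1 := mul_le_mul_of_nonneg_left (ih (k - if x + 1 = 0 then 1 else 0) (x+1)) hp
    have h2 := mul_le_mul_of_nonneg_left (ih (k - if x - 1 = 0 then 1 else 0) (x-1)) hq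
    linarith

/-- a sequence with geometric increments -/
lemma geom_incr (u : ℕ → ℝ) (r : ℝ) (h : ∀ i, u (i+2) - u (i+1) = r * (u (i+1) - u i)) (i : ℕ) :
    u (i+1) - u i = r^i * (u 1 - u 0) := by
  induction i with
  | zero => simp
  | succ i ih => rw [h, ih]; ring

lemma fR_tendsto (hq : 0 < q) (hq2 : q < 1/2) (hpq : p + q = 1) :
    Tendsto (fun T => fR p q T 1 0) atTop (nhds (2*q)) := by
  have hp : 0 < p := by linarith
  have hqp : q < p := by linarith
  have hlim : ∀ x, ∃ g, Tendsto (fun T => fR p q T 1 x) atTop (nhds g) := by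
    intro x
    refine ⟨_, tendsto_atTop_ciSup
      (monotone_nat_of_le_succ (fun n => fR_mono hp.le hq.le hpq n 1 x)) ⟨1, ?_⟩⟩
    rintro _ ⟨n, rfl⟩
    exact fR_le_one hp.le hq.le hpq n 1 x
  choose G hG using hlim
  have hG0 : ∀ x, 0 ≤ G x := fun x => ge_of_tendsto' (hG x) (fun n => fR_nonneg hp.le hq.le n 1 x)
  have hG1 : ∀ x, G x ≤ 1 := fun x => le_of_tendsto' (hG x) (fun n => fR_le_one hp.le hq.le hpq n 1 x)
  have hGh : ∀ x, G x ≤ hR p q x := fun x => le_of_tendsto' (hG x) (fun n => by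
    simpa using fR_le hp hq hpq n 0 x)
  set G' : ℤ → ℝ := fun x => if x = 0 then 1 else G x with hG'
  have hlim' : ∀ y : ℤ, Tendsto (fun T => fR p q T (1 - if y = 0 then 1 else 0) y) atTop
      (nhds (G' y)) := by
    intro y
    by_cases hy : y = 0
    · subst hy; simp [G', fR_zero hpq]
    · simp only [hy, G', if_false]; exact hG y
  have hrec : ∀ x, G x = p * G' (x+1) + q * G' (x-1) := by
    intro x
    refine tendsto_nhds_unique ((tendsto_add_atTop_iff_nat 1).2 (hG x)) ?_
    simp only [fR]
    exact ((hlim' _).const_mul p).add ((hlim' _).const_mul q)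
  have hG'0 : G' 0 = 1 := by simp [G']
  have hG'n : ∀ x, x ≠ 0 → G' x = G x := fun x hx => by simp [G', hx]
  -- left side
  have hL : G (-1) = 1 := by
    have hinc := geom_incr (fun i : ℕ => 1 - G' (-(i:ℤ))) (p/q) (by
      intro i
      have h := hrec (-((i+1 : ℕ):ℤ))
      rw [← hG'n _ (by push_cast; omega)] at h
      rw [show -((i+1 : ℕ):ℤ) + 1 = -(i:ℤ) by push_cast; ring,
        show -((i+1 : ℕ):ℤ) - 1 = -((i+2 : ℕ):ℤ) by push_cast; ring] at h
      have hp' : p = 1 - q := by linarith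
      field_simp
      subst hp'
      linarith)
    simp only [Nat.cast_one, Nat.cast_zero, neg_zero, hG'0] at hinc
    rw [hG'n (-1) (by norm_num)] at hinc
    by_contra hne
    have hpos : 0 < 1 - G (-1) := by
      have := hG1 (-1)
      exact lt_of_le_of_ne (by linarith) (fun h => hne (by linarith))
    have hbig : Tendsto (fun i : ℕ => (p/q)^i * (1 - G (-1))) atTop atTop :=
      (tendsto_pow_atTop_atTop_of_one_lt ((one_lt_div hq).2 hqp)).atTop_mul_const hpos
    obtain ⟨i, hi⟩ := (hbig.eventually_gt_atTop 1).exists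
    have h1 := hinc i
    have h2 : 0 ≤ G' (-((i+1:ℕ):ℤ)) := by
      rw [hG'n _ (by push_cast; omega)]; exact hG0 _
    have h3 : G' (-(i:ℤ)) ≤ 1 := by
      simp only [G']; split_ifs
      · exact le_rfl
      · exact hG1 _
    linarith
  have hRt : G 1 = q/p := by
    set r := q/p with hr
    have hr0 : 0 < r := by positivity
    have hr1 : r < 1 := (div_lt_one hp).2 hqp
    have hinc := geom_incr (fun i : ℕ => G' (i:ℤ)) r (by
      intro i
      have h := hrec (((i+1 : ℕ):ℤ))
      rw [← hG'n _ (by push_cast; omega)] at h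
      rw [show ((i+1 : ℕ):ℤ) + 1 = ((i+2:ℕ):ℤ) by push_cast; ring,
        show ((i+1 : ℕ):ℤ) - 1 = (i:ℤ) by push_cast; ring] at h
      simp only [hr]
      have hp' : q = 1 - p := by linarith
      field_simp
      subst hp'
      linarith)
    simp only [Nat.cast_one, Nat.cast_zero, hG'0] at hinc
    rw [hG'n 1 (by norm_num)] at hinc
    have hval : ∀ i : ℕ, (1 - r) * G' (i:ℤ) = (1 - r) + (1 - r^i) * (G 1 - 1) := by
      intro i
      induction i with
      | zero => simp [hG'0]
      | succ i ih =>
        have : G' ((i+1:ℕ):ℤ) = G' (i:ℤ) + r^i * (G 1 - 1) := by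
          have := hinc i; linarith
        rw [this, mul_add, ih]; ring
    have ht : Tendsto (fun i : ℕ => r^i) atTop (nhds 0) :=
      tendsto_pow_atTop_nhds_zero_of_lt_one hr0.le hr1
    have h0 : Tendsto (fun i : ℕ => G' (i:ℤ)) atTop (nhds 0) := by
      rw [← tendsto_add_atTop_iff_nat 1]
      refine squeeze_zero (fun i => ?_) (fun i => ?_) ((tendsto_add_atTop_iff_nat 1).2 ht)
      · rw [hG'n _ (by push_cast; omega)]; exact hG0 _
      · rw [hG'n _ (by push_cast; omega)]
        refine (hGh _).trans (le_of_eq ?_)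
        push_cast
        exact hR_pos i
    have e1 := h0.const_mul (1 - r)
    have e2 : Tendsto (fun i : ℕ => (1 - r) * G' (i:ℤ)) atTop
        (nhds ((1 - r) + (1 - 0) * (G 1 - 1))) := by
      simp only [hval]
      exact ((ht.const_sub 1).mul_const _).const_add _
    have := tendsto_nhds_unique e1 e2
    linarith
  have h := hrec 0
  rw [zero_add, zero_sub, hG'n 1 (by norm_num), hG'n (-1) (by norm_num), hL, hRt] at h
  have : G 0 = 2*q := by rw [h]; field_simp; ring
  rw [← this]
  exact hG 0

end det

section prob
variable [MeasurableSpace Ω] {P : Measure Ω} [IsProbabilityMeasure P] {X : ℕ → Ω → ℤ} {p q : ℝ}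

lemma cyl_eq (X : ℕ → Ω → ℤ) (A : (ℕ → ℤ) → Prop) (s : Finset ℕ)
    (hA : ∀ w w' : ℕ → ℤ, (∀ i ∈ s, w i = w' i) → (A w ↔ A w')) :
    {ω | A (fun i => X i ω)} = (fun ω (i : s) => X i ω) ⁻¹'
      {v : s → ℤ | A (fun i => if h : i ∈ s then v ⟨i, h⟩ else 0)} := by
  ext ω
  simp only [Set.mem_ofPred_eq, Set.mem_preimage]
  apply hA
  intro i hi
  simp [hi]

lemma cyl_meas (hm : ∀ i, Measurable (X i)) (A : (ℕ → ℤ) → Prop) (s : Finset ℕ)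
    (hA : ∀ w w' : ℕ → ℤ, (∀ i ∈ s, w i = w' i) → (A w ↔ A w')) :
    MeasurableSet {ω | A (fun i => X i ω)} := by
  rw [cyl_eq X A s hA]
  have : Measurable (fun ω (i : s) => X i ω) := measurable_pi_lambda _ (fun i => hm i)
  exact this (Set.to_countable _).measurableSet

lemma cyl_indep (hm : ∀ i, Measurable (X i)) (hi : iIndepFun X P) (A C : (ℕ → ℤ) → Prop)
    (s t : Finset ℕ) (hst : Disjoint s t)
    (hA : ∀ w w' : ℕ → ℤ, (∀ i ∈ s, w i = w' i) → (A w ↔ A w'))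
    (hC : ∀ w w' : ℕ → ℤ, (∀ i ∈ t, w i = w' i) → (C w ↔ C w')) :
    P.real {ω | A (fun i => X i ω) ∧ C (fun i => X i ω)} =
      P.real {ω | A (fun i => X i ω)} * P.real {ω | C (fun i => X i ω)} := by
  have h := hi.indepFun_finset s t hst hm
  have h2 := h.measure_inter_preimage_eq_mul
    {v : s → ℤ | A (fun i => if h : i ∈ s then v ⟨i, h⟩ else 0)}
    {v : t → ℤ | C (fun i => if h : i ∈ t then v ⟨i, h⟩ else 0)}
    (Set.to_countable _).measurableSet (Set.to_countable _).measurableSet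
  rw [← cyl_eq X A s hA, ← cyl_eq X C t hC] at h2
  have h3 : {ω | A (fun i => X i ω) ∧ C (fun i => X i ω)} =
    {ω | A (fun i => X i ω)} ∩ {ω | C (fun i => X i ω)} := rfl
  rw [h3, Measure.real, h2, ENNReal.toReal_mul]
  rfl

lemma wcnt_dep (j n k : ℕ) (x : ℤ) (w w' : ℕ → ℤ) (h : ∀ i ∈ Finset.Ico j (j+n), w i = w' i) :
    (k ≤ wcnt n (fun i => w (j+i)) x) ↔ (k ≤ wcnt n (fun i => w' (j+i)) x) := by
  rw [wcnt_congr n (fun i => w (j+i)) (fun i => w' (j+i)) x]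
  intro i hi
  apply h
  simp; omega

lemma ae_pm (hq : 0 < q) (hp : 0 < p) (hpq : p + q = 1) (hX : IsAsymmetricSRW P X p q) (j : ℕ) :
    ∀ᵐ ω ∂P, X j ω = 1 ∨ X j ω = -1 := by
  obtain ⟨hm, -, h1, h2⟩ := hX
  have hm1 : MeasurableSet {ω | X j ω = 1} := hm j (measurableSet_singleton 1)
  have hm2 : MeasurableSet {ω | X j ω = -1} := hm j (measurableSet_singleton (-1))
  have hu : P ({ω | X j ω = 1} ∪ {ω | X j ω = -1}) = 1 := by
    rw [measure_union _ hm2, h1, h2, ← ENNReal.ofReal_add hp.le hq.le, hpq, ENNReal.ofReal_one]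
    rw [Set.disjoint_left]
    intro ω ha hb
    simp only [Set.mem_ofPred_eq] at ha hb
    omega
  have := (prob_compl_eq_zero_iff (hm1.union hm2)).2 hu
  exact this

lemma wcnt_law (hq : 0 < q) (hp : 0 < p) (hpq : p + q = 1) (hX : IsAsymmetricSRW P X p q)
    (n j k : ℕ) (x : ℤ) :
    P.real {ω | k ≤ wcnt n (fun i => X (j+i) ω) x} = fR p q n k x := by
  induction n generalizing j k x with
  | zero =>
    by_cases hk : k = 0
    · simp [hk, fR]
    · simp [wcnt, hk, fR]
  | succ n ih =>
    have hpm := ae_pm hq hp hpq hX j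
    obtain ⟨hm, hi, h1, h2⟩ := hX
    have key : ∀ a : ℤ, P.real {ω | X j ω = a ∧
        k - (if x + a = 0 then 1 else 0) ≤ wcnt n (fun i => X (j+1+i) ω) (x + a)} =
        P.real {ω | X j ω = a} * fR p q n (k - if x + a = 0 then 1 else 0) (x+a) := by
      intro a
      rw [← ih (j+1)]
      refine cyl_indep hm hi (fun w => w j = a) (fun w => k - (if x + a = 0 then 1 else 0) ≤
        wcnt n (fun i => w (j+1+i)) (x + a)) {j} (Finset.Ico (j+1) (j+1+n)) (by simp) ?_ ?_
      · intro w w' h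
        rw [h j (by simp)]
      · intro w w' h
        exact wcnt_dep _ _ _ _ _ _ h
    have hms : MeasurableSet {ω | X j ω = -1 ∧
        k - (if x + -1 = 0 then 1 else 0) ≤ wcnt n (fun i => X (j+1+i) ω) (x + -1)} := by
      refine MeasurableSet.inter (hm j (measurableSet_singleton (-1))) ?_
      exact cyl_meas hm (fun w => k - (if x + -1 = 0 then 1 else 0) ≤
        wcnt n (fun i => w (j+1+i)) (x + -1)) (Finset.Ico (j+1) (j+1+n))
        (fun w w' h => wcnt_dep _ _ _ _ _ _ h)
    have hsplit : P.real {ω | k ≤ wcnt (n+1) (fun i => X (j+i) ω) x} =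
        P.real ({ω | X j ω = 1 ∧
        k - (if x + 1 = 0 then 1 else 0) ≤ wcnt n (fun i => X (j+1+i) ω) (x + 1)} ∪
        {ω | X j ω = -1 ∧
        k - (if x + -1 = 0 then 1 else 0) ≤ wcnt n (fun i => X (j+1+i) ω) (x + -1)}) := by
      apply measureReal_congr
      filter_upwards [hpm] with ω hω
      apply propext
      change (k ≤ wcnt (n+1) (fun i => X (j+i) ω) x) ↔ ((X j ω = 1 ∧ _ ≤ _) ∨ (X j ω = -1 ∧ _ ≤ _))
      rw [wcnt_succ]
      have e : (fun i => X (j + (i+1)) ω) = (fun i => X (j+1+i) ω) := by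
        funext i; congr 1; ring
      simp only [add_zero, e]
      rcases hω with h | h
      · rw [h, tsub_le_iff_left]; simp
      · rw [h, tsub_le_iff_left (a := k) (c := wcnt n (fun i => X (j+1+i) ω) (x + -1))]; simp
    rw [hsplit, measureReal_union _ hms, key, key, fR]
    · have e1 : P.real {ω | X j ω = 1} = p := by
        rw [Measure.real, h1, ENNReal.toReal_ofReal hp.le]
      have e2 : P.real {ω | X j ω = -1} = q := by
        rw [Measure.real, h2, ENNReal.toReal_ofReal hq.le]
      rw [e1, e2]; rfl
    · rw [Set.disjoint_left]
      rintro ω ⟨ha, -⟩ ⟨hb, -⟩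
      omega

lemma block_law (hq : 0 < q) (hp : 0 < p) (hpq : p + q = 1) (hX : IsAsymmetricSRW P X p q)
    (L k B : ℕ) :
    P.real {ω | ∀ b < B, ¬ k ≤ wcnt L (fun i => X (b*L+i) ω) 0} = (1 - fR p q L k 0)^B := by
  induction B with
  | zero => simp
  | succ B ih =>
    have hm := hX.1
    have hi := hX.2.1
    have e : {ω | ∀ b < B+1, ¬ k ≤ wcnt L (fun i => X (b*L+i) ω) 0} =
        {ω | (∀ b < B, ¬ k ≤ wcnt L (fun i => X (b*L+i) ω) 0) ∧
          ¬ k ≤ wcnt L (fun i => X (B*L+i) ω) 0} := by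
      ext ω
      simp only [Set.mem_ofPred_eq, Nat.forall_lt_succ_right]
    have hd : ∀ w w' : ℕ → ℤ, (∀ i ∈ Finset.Ico (B*L) (B*L+L), w i = w' i) →
        ((¬ k ≤ wcnt L (fun i => w (B*L+i)) 0) ↔ (¬ k ≤ wcnt L (fun i => w' (B*L+i)) 0)) :=
      fun w w' h => not_congr (wcnt_dep _ _ _ _ _ _ h)
    rw [e, cyl_indep hm hi (fun w => ∀ b < B, ¬ k ≤ wcnt L (fun i => w (b*L+i)) 0)
      (fun w => ¬ k ≤ wcnt L (fun i => w (B*L+i)) 0) (Finset.range (B*L))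
      (Finset.Ico (B*L) (B*L+L)) ?_ ?_ hd, ih, pow_succ]
    · congr 1
      rw [← wcnt_law hq hp hpq hX L (B*L) k 0]
      rw [← probReal_compl_eq_one_sub]
      · rfl
      · exact cyl_meas hm (fun w => k ≤ wcnt L (fun i => w (B*L+i)) 0)
          (Finset.Ico (B*L) (B*L+L)) (fun w w' h => wcnt_dep _ _ _ _ _ _ h)
    · rw [Finset.disjoint_left]
      intro i; simp; omega
    · intro w w' h
      refine forall₂_congr (fun b hb => not_congr (wcnt_dep _ _ _ _ _ _ ?_))
      intro i hi
      apply h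
      simp at hi ⊢
      have : (b+1)*L ≤ B*L := Nat.mul_le_mul_right L hb
      rw [add_mul, one_mul] at this
      omega

lemma upper_prob (hq : 0 < q) (hp : 0 < p) (hpq : p + q = 1) (hX : IsAsymmetricSRW P X p q)
    (n k : ℕ) :
    P.real {ω | k + 1 ≤ maxLocalTime X n ω} ≤ (n+1) * (2*q)^k := by
  calc P.real {ω | k + 1 ≤ maxLocalTime X n ω}
      ≤ P.real (⋃ j ∈ Finset.range (n+1), {ω | k ≤ wcnt n (fun i => X (j+i) ω) 0}) := by
        apply measureReal_mono _ (measure_ne_top _ _)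
        intro ω hω
        obtain ⟨j, hj, h⟩ := max_le_wcnt X n k ω hω
        simp only [Set.mem_iUnion]
        exact ⟨j, hj, h⟩
    _ ≤ ∑ j ∈ Finset.range (n+1), P.real {ω | k ≤ wcnt n (fun i => X (j+i) ω) 0} :=
        measureReal_biUnion_finset_le _ _
    _ ≤ ∑ j ∈ Finset.range (n+1), (2*q)^k := by
        apply Finset.sum_le_sum
        intro j _
        rw [wcnt_law hq hp hpq hX]
        exact fR_le_pow hp hq hpq n k
    _ = (n+1) * (2*q)^k := by simp

lemma lower_prob (hq : 0 < q) (hp : 0 < p) (hpq : p + q = 1) (hX : IsAsymmetricSRW P X p q)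
    (n k B T : ℕ) (hB : B * (k * T) ≤ n) (g : ℝ) (hg0 : 0 ≤ g) (hg : g ≤ fR p q T 1 0) :
    P.real {ω | maxLocalTime X n ω < k} ≤ Real.exp (-(g^k * B)) := by
  calc P.real {ω | maxLocalTime X n ω < k}
      ≤ P.real {ω | ∀ b < B, ¬ k ≤ wcnt (k*T) (fun i => X (b*(k*T)+i) ω) 0} := by
        apply measureReal_mono _ (measure_ne_top _ _)
        intro ω hω b hb hk
        have : (b+1)*(k*T) ≤ B*(k*T) := Nat.mul_le_mul_right _ hb
        rw [add_mul, one_mul] at this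
        have h2 := wcnt_le_max X (b*(k*T)) (k*T) n (by omega) ω
        have h3 : maxLocalTime X n ω < k := hω
        omega
    _ = (1 - fR p q (k*T) k 0)^B := block_law hq hp hpq hX _ _ _
    _ ≤ (Real.exp (-g^k))^B := by
        have h1 := fR_le_one hp.le hq.le hpq (k*T) k 0
        have h2 := fR_pow hp.le hq.le hpq T k
        have h3 : g^k ≤ fR p q T 1 0 ^ k := pow_le_pow_left₀ hg0 hg k
        apply pow_le_pow_left₀ (by linarith)
        have := Real.add_one_le_exp (-g^k)
        linarith
    _ = Real.exp (-(g^k * B)) := by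
        rw [← Real.exp_nat_mul]; congr 1; ring

end prob

section asymp
variable [MeasurableSpace Ω] {P : Measure Ω} [IsProbabilityMeasure P] {X : ℕ → Ω → ℤ} {p q : ℝ}

lemma bc (s : ℕ → Set Ω) (u : ℕ → ℝ) (hu : Summable u) (h : ∀ᶠ m in atTop, P.real (s m) ≤ u m) :
    ∀ᵐ ω ∂P, ∀ᶠ m in atTop, ω ∉ s m := by
  apply ae_eventually_notMem
  have hs : Summable (fun m => P.real (s m)) := by
    refine Summable.of_norm_bounded_eventually_nat hu ?_
    filter_upwards [h] with m hm
    rwa [Real.norm_of_nonneg measureReal_nonneg]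
  have := hs.tsum_ofReal_ne_top
  simpa using this

lemma upper_ae (hq : 0 < q) (hp : 0 < p) (hq2 : q < 1/2) (hpq : p + q = 1)
    (hX : IsAsymmetricSRW P X p q) (a : ℝ) (ha0 : 0 < a) (ha : a * Real.log (2*q) < -1) :
    ∀ᵐ ω ∂P, ∀ᶠ m : ℕ in atTop, (maxLocalTime X (2^m) ω : ℝ) ≤ a * Real.log 2 * m := by
  have hl2 : 0 < Real.log 2 := Real.log_pos (by norm_num)
  set c := a * Real.log 2 with hc
  have hc0 : 0 < c := by positivity
  set γ := 2 * q with hγ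
  have hγ0 : 0 < γ := by positivity
  have hγ1 : γ < 1 := by linarith
  set θ := 2 * γ^c with hθ
  have hθ0 : 0 < θ := by positivity
  have hθ1 : θ < 1 := by
    rw [← Real.log_neg_iff hθ0, hθ, Real.log_mul (by norm_num) (by positivity),
      Real.log_rpow hγ0, hc]
    nlinarith
  have hsum : Summable (fun m : ℕ => 2 * γ⁻¹ * θ^m) :=
    (summable_geometric_of_lt_one hθ0.le hθ1).mul_left _
  have := bc (P := P) (fun m => {ω | ⌊c * m⌋₊ + 1 ≤ maxLocalTime X (2^m) ω}) _ hsum (by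
    refine Eventually.of_forall (fun m => ?_)
    refine (upper_prob hq hp hpq hX (2^m) ⌊c * m⌋₊).trans ?_
    have h1 : γ ^ ⌊c * m⌋₊ ≤ γ⁻¹ * (γ^c)^m := by
      rw [← Real.rpow_natCast, ← Real.rpow_natCast, ← Real.rpow_mul hγ0.le, ← Real.rpow_neg_one,
        ← Real.rpow_add hγ0]
      apply Real.rpow_le_rpow_of_exponent_ge hγ0 hγ1.le
      have := Nat.lt_floor_add_one (c * m)
      linarith
    have h2 : (1:ℝ) ≤ 2^m := one_le_pow₀ (by norm_num)
    push_cast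
    calc ((2:ℝ)^m + 1) * γ ^ ⌊c * m⌋₊ ≤ (2 * 2^m) * (γ⁻¹ * (γ^c)^m) := by
          gcongr; linarith
      _ = _ := by rw [hθ, mul_pow]; ring)
  filter_upwards [this] with ω hω
  filter_upwards [hω] with m hm
  have hm' : maxLocalTime X (2^m) ω ≤ ⌊c * m⌋₊ := by
    have : ¬ (⌊c * m⌋₊ + 1 ≤ maxLocalTime X (2^m) ω) := hm
    omega
  exact (Nat.le_floor_iff (by positivity)).1 hm'

lemma lower_ae (hq : 0 < q) (hp : 0 < p) (hq2 : q < 1/2) (hpq : p + q = 1)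
    (hX : IsAsymmetricSRW P X p q) (a : ℝ) (ha0 : 0 < a) (ha : -1 < a * Real.log (2*q)) :
    ∀ᵐ ω ∂P, ∀ᶠ m : ℕ in atTop, a * Real.log 2 * m ≤ (maxLocalTime X (2^m) ω : ℝ) := by
  have hl2 : 0 < Real.log 2 := Real.log_pos (by norm_num)
  set c := a * Real.log 2 with hc
  have hc0 : 0 < c := by positivity
  obtain ⟨g, hg1, hg2⟩ : ∃ g, Real.exp (-1/a) < g ∧ g < 2*q := by
    apply exists_between
    rw [← Real.lt_log_iff_exp_lt (by positivity), div_lt_iff₀ ha0]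
    linarith
  have hg0 : 0 < g := (Real.exp_pos _).trans hg1
  have hg1' : g < 1 := by linarith
  have hag : -1 < a * Real.log g := by
    rw [← Real.lt_log_iff_exp_lt hg0, div_lt_iff₀ ha0] at hg1
    linarith
  obtain ⟨T, hT, hT1⟩ := (((fR_tendsto hq hq2 hpq).eventually_const_lt hg2).and
    (eventually_ge_atTop 1)).exists
  set θ := 2 * g^c with hθ
  have hθ0 : 0 < θ := by positivity
  have hθ1 : 1 < θ := by
    rw [← Real.log_pos_iff hθ0.le, hθ, Real.log_mul (by norm_num) (by positivity),
      Real.log_rpow hg0, hc]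
    nlinarith
  set K : ℝ := (c+1) * T with hK
  have hT0 : (0:ℝ) < T := by exact_mod_cast hT1
  have hK0 : 0 < K := by positivity
  have ev1 : ∀ᶠ m : ℕ in atTop, 2 * K * m ≤ 2^m := by
    have h := tendsto_pow_const_div_const_pow_of_one_lt 1 (r := (2:ℝ)) (by norm_num)
    have h2 := h.eventually_lt_const (show (0:ℝ) < 1/(2*K) by positivity)
    filter_upwards [h2] with m hm
    rw [div_lt_div_iff₀ (by positivity) (by positivity)] at hm
    linarith
  have ev2 : ∀ᶠ m : ℕ in atTop, (2 * K / g) * (m:ℝ)^2 ≤ θ^m := by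
    have h := tendsto_pow_const_div_const_pow_of_one_lt 2 hθ1
    have h2 := h.eventually_lt_const (show (0:ℝ) < 1/(2*K/g) by positivity)
    filter_upwards [h2] with m hm
    rw [div_lt_div_iff₀ (by positivity) (by positivity)] at hm
    linarith
  have hsum : Summable (fun m : ℕ => Real.exp (-(m:ℝ))) := Real.summable_exp_neg_nat
  have := bc (P := P) (fun m => {ω | maxLocalTime X (2^m) ω < ⌈c * m⌉₊}) _ hsum (by
    filter_upwards [ev1, ev2, eventually_ge_atTop 1] with m h1 h2 hm
    set k := ⌈c * m⌉₊ with hk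
    have hm1 : (1:ℝ) ≤ m := by exact_mod_cast hm
    have hk0 : 0 < k := Nat.ceil_pos.2 (by positivity)
    have hk1 : (k:ℝ) < c * m + 1 := Nat.ceil_lt_add_one (by positivity)
    set B := 2^m / (k*T) with hB
    refine (lower_prob hq hp hpq hX (2^m) k B T (Nat.div_mul_le_self _ _) g hg0.le hT.le).trans ?_
    apply Real.exp_le_exp.2
    apply neg_le_neg
    have hkT : (k:ℝ) * T ≤ K * m := by
      rw [hK]
      have : (k:ℝ) ≤ (c+1)*m := by linarith
      calc (k:ℝ) * T ≤ (c+1)*m * T := by gcongr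
        _ = _ := by ring
    have hBr : (2:ℝ)^m ≤ K * m * (B+1) := by
      have h := (Nat.lt_mul_div_succ (2^m) (show 0 < k*T by positivity)).le
      have h' : (2:ℝ)^m ≤ (k*T) * (B+1) := by exact_mod_cast h
      exact h'.trans (by gcongr)
    have hB2 : (2:ℝ)^m / (2 * K * m) ≤ B := by
      rw [div_le_iff₀ (by positivity)]
      linarith
    have hgk : g * (g^c)^m ≤ g^k := by
      rw [← Real.rpow_natCast, ← Real.rpow_natCast, ← Real.rpow_mul hg0.le]
      nth_rewrite 1 [← Real.rpow_one g]
      rw [← Real.rpow_add hg0]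
      apply Real.rpow_le_rpow_of_exponent_ge hg0 hg1'.le
      linarith
    calc (m:ℝ) = (g * ((2 * K / g) * (m:ℝ)^2)) / (2*K*m) := by field_simp
      _ ≤ (g * θ^m) / (2*K*m) := by gcongr
      _ = (g * (g^c)^m) * ((2:ℝ)^m / (2 * K * m)) := by rw [hθ, mul_pow]; ring
      _ ≤ g^k * B := by gcongr)
  filter_upwards [this] with ω hω
  filter_upwards [hω] with m hm
  have hm' : ⌈c * m⌉₊ ≤ maxLocalTime X (2^m) ω := by
    have : ¬ (maxLocalTime X (2^m) ω < ⌈c * m⌉₊) := hm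
    omega
  exact Nat.ceil_le.1 hm'

end asymp

/-- Almost surely, `ξ(n)/log n → λ = -1/log(2q)`. -/
theorem maxLocalTime_growth
    [MeasurableSpace Ω] (P : Measure Ω) [IsProbabilityMeasure P]
    (X : ℕ → Ω → ℤ) (p q : ℝ) (hq0 : 0 < q) (hq : q < 1/2) (hpq : p + q = 1)
    (hX : IsAsymmetricSRW P X p q) :
    ∀ᵐ ω ∂P,
      Filter.Tendsto (fun n : ℕ => (maxLocalTime X n ω : ℝ) / Real.log n) atTop
        (nhds (-1 / Real.log (2*q))) := by
  have hp : 0 < p := by linarith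
  have hl2 : 0 < Real.log 2 := Real.log_pos (by norm_num)
  have hL : Real.log (2*q) < 0 := Real.log_neg (by linarith) (by linarith)
  set lam := -1 / Real.log (2*q) with hlam
  have hlam0 : 0 < lam := div_pos_of_neg_of_neg (by norm_num) hL
  have hup : ∀ᵐ ω ∂P, ∀ a : ℚ, lam < a →
      ∀ᶠ m : ℕ in atTop, (maxLocalTime X (2^m) ω : ℝ) ≤ a * Real.log 2 * m := by
    rw [ae_all_iff]
    intro a
    by_cases h : lam < a
    · have := upper_ae hq0 hp hq hpq hX a (hlam0.trans h) (by
        rw [hlam, div_lt_iff_of_neg hL] at h; exact h)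
      filter_upwards [this] with ω hω _ using hω
    · exact Eventually.of_forall (fun ω h' => absurd h' h)
  have hlo : ∀ᵐ ω ∂P, ∀ a : ℚ, 0 < (a:ℝ) → a < lam →
      ∀ᶠ m : ℕ in atTop, a * Real.log 2 * m ≤ (maxLocalTime X (2^m) ω : ℝ) := by
    rw [ae_all_iff]
    intro a
    by_cases h : 0 < (a:ℝ) ∧ a < lam
    · have := lower_ae hq0 hp hq hpq hX a h.1 (by
        have h2 := h.2
        rw [hlam, lt_div_iff_of_neg hL] at h2; exact h2)
      filter_upwards [this] with ω hω _ _ using hω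
    · exact Eventually.of_forall (fun ω h1 h2 => absurd ⟨h1, h2⟩ h)
  have hlogn : Tendsto (fun n : ℕ => Real.log n) atTop atTop :=
    Real.tendsto_log_atTop.comp tendsto_natCast_atTop_atTop
  have hnl : Tendsto (fun n : ℕ => Nat.log 2 n) atTop atTop := by
    refine tendsto_atTop.2 (fun b => ?_)
    filter_upwards [eventually_ge_atTop (2^b)] with n hn
    exact Nat.le_log_of_pow_le (by norm_num) hn
  have hlow : ∀ n : ℕ, 1 ≤ n → (Nat.log 2 n : ℝ) * Real.log 2 ≤ Real.log n := by
    intro n hn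
    rw [← Real.log_pow]
    apply Real.log_le_log (by positivity)
    exact_mod_cast Nat.pow_log_le_self 2 (by omega)
  have hhigh : ∀ n : ℕ, 1 ≤ n → Real.log n ≤ ((Nat.log 2 n : ℝ) + 1) * Real.log 2 := by
    intro n hn
    have : Real.log n ≤ Real.log (2^(Nat.log 2 n + 1)) := by
      apply Real.log_le_log (by exact_mod_cast hn)
      exact_mod_cast (Nat.lt_pow_succ_log_self (by norm_num) n).le
    rw [Real.log_pow] at this
    exact_mod_cast this
  filter_upwards [hup, hlo] with ω hu hl
  rw [tendsto_order]
  constructor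
  · intro b hb
    obtain ⟨a, ha1, ha2⟩ := exists_rat_btwn (max_lt hb hlam0)
    have ha0 : 0 < (a:ℝ) := (le_max_right _ _).trans_lt ha1
    have hba : b < a := (le_max_left _ _).trans_lt ha1
    have ev := hnl.eventually (hl a ha0 ha2)
    filter_upwards [ev, eventually_ge_atTop 1, hlogn.eventually_gt_atTop 0,
      hlogn.eventually_gt_atTop (a * Real.log 2 / (a - b))] with n h1 h2 h3 h4
    rw [lt_div_iff₀ h3]
    rw [div_lt_iff₀ (by linarith)] at h4
    have h5 : (maxLocalTime X (2^(Nat.log 2 n)) ω : ℝ) ≤ maxLocalTime X n ω := by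
      exact_mod_cast maxLocalTime_mono X (Nat.pow_log_le_self 2 (by omega)) ω
    have h6 := mul_le_mul_of_nonneg_left (hhigh n h2) ha0.le
    nlinarith
  · intro b hb
    obtain ⟨a, ha1, ha2⟩ := exists_rat_btwn hb
    have ha0 : 0 < (a:ℝ) := hlam0.trans ha1
    have ev := ((tendsto_add_atTop_nat 1).comp hnl).eventually (hu a ha1)
    filter_upwards [ev, eventually_ge_atTop 1, hlogn.eventually_gt_atTop 0,
      hlogn.eventually_gt_atTop (a * Real.log 2 / (b - a))] with n h1 h2 h3 h4
    rw [div_lt_iff₀ h3]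
    rw [div_lt_iff₀ (by linarith)] at h4
    have h5 : (maxLocalTime X n ω : ℝ) ≤ maxLocalTime X (2^(Nat.log 2 n + 1)) ω := by
      exact_mod_cast maxLocalTime_mono X (Nat.lt_pow_succ_log_self (by norm_num) n).le ω
    have h6 := mul_le_mul_of_nonneg_left (hlow n h2) ha0.le
    simp only [Function.comp] at h1
    push_cast at h1
    nlinarith
end

section
/- For every A > 0 there exists a constant C > 0 such that for all positive integers n, sup_{z ∈ ℤ, z ≥ 1} P(ξ(0,∞) + ξ(z,∞) > 2λA log n) ≤ C n^{-A(1+δ)}. -/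
open MeasureTheory ProbabilityTheory Filter Set
open scoped ENNReal NNReal

variable {Ω : Type*}

open Classical in
/-- Number of visits to `I` of the walk started at `x` driven by steps `j, j+1, …`. -/
noncomputable def cntV (X : ℕ → Ω → ℤ) (I : ℤ → Prop) (j n : ℕ) (x : ℤ) (ω : Ω) : ℕ :=
  ∑ k ∈ Finset.range n, if I (x + ∑ i ∈ Finset.range (k+1), X (j+i) ω) then 1 else 0

open Classical in
lemma cntV_succ (X : ℕ → Ω → ℤ) (I : ℤ → Prop) (j n : ℕ) (x : ℤ) (ω : Ω) :
    cntV X I j (n+1) x ω = cntV X I (j+1) n (x + X j ω) ω + (if I (x + X j ω) then 1 else 0) := by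
  unfold cntV
  rw [Finset.sum_range_succ']
  congr 1
  · refine Finset.sum_congr rfl fun k _ => ?_
    rw [Finset.sum_range_succ' _ (k+1)]
    have : ∀ i, X (j + (i+1)) ω = X (j + 1 + i) ω := fun i => by
      rw [show j + (i+1) = j + 1 + i by ring]
    rw [Finset.sum_congr rfl (fun i _ => this i), add_zero, add_comm (∑ i ∈ Finset.range (k+1), X (j+1+i) ω), ← add_assoc]
  · simp

lemma cntV_meas (X : ℕ → Ω → ℤ) (I : ℤ → Prop) (n : ℕ) : ∀ (j : ℕ) (x : ℤ),
    Measurable[⨆ i ∈ Set.Ici j, MeasurableSpace.comap (X i) ⊤] (cntV X I j n x) := by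
  classical
  intro j x
  let M : MeasurableSpace Ω := ⨆ i ∈ Set.Ici j, MeasurableSpace.comap (X i) ⊤
  have hm : ∀ i, j ≤ i → Measurable[M] (X i) := by
    intro i hi
    have h1 : MeasurableSpace.comap (X i) ⊤ ≤ M :=
      le_iSup₂ (f := fun (i : ℕ) (_ : i ∈ Set.Ici j) => MeasurableSpace.comap (X i) ⊤) i hi
    exact (measurable_iff_comap_le).2 h1
  unfold cntV
  refine Finset.measurable_sum _ fun k _ => ?_
  have h2 : Measurable[M] (fun ω => x + ∑ i ∈ Finset.range (k+1), X (j+i) ω) :=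
    (Finset.measurable_sum _ fun i _ => hm _ (Nat.le_add_right _ _)).const_add x
  have h3 : Measurable (fun y : ℤ => if I y then (1:ℕ) else 0) := measurable_from_top
  exact h3.comp h2

lemma step_indep [MeasurableSpace Ω] (P : Measure Ω) [IsProbabilityMeasure P]
    (X : ℕ → Ω → ℤ) (hm : ∀ i, Measurable (X i)) (hi : iIndepFun X P) (I : ℤ → Prop)
    (j n : ℕ) (y v : ℤ) (B : Set ℕ) :
    P ({ω | X j ω = v} ∩ (cntV X I (j+1) n y) ⁻¹' B) =
      P {ω | X j ω = v} * P ((cntV X I (j+1) n y) ⁻¹' B) := by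
  have h := indep_iSup_of_disjoint (m := fun i => MeasurableSpace.comap (X i) ⊤)
    (fun i => (hm i).comap_le) hi (S := {j}) (T := Set.Ici (j+1)) (by
      rw [Set.disjoint_singleton_left]; simp)
  rw [Indep_iff] at h
  apply h
  · have : MeasurableSet[MeasurableSpace.comap (X j) ⊤] {ω | X j ω = v} := ⟨{v}, trivial, rfl⟩
    rw [iSup_singleton]
    exact this
  · exact cntV_meas X I n (j+1) y trivial

lemma key_bound [MeasurableSpace Ω] (P : Measure Ω) [IsProbabilityMeasure P]
    (X : ℕ → Ω → ℤ) (p q : ℝ) (hp0 : 0 < p) (hq0 : 0 < q) (hpq : p + q = 1)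
    (hX : IsAsymmetricSRW P X p q) (I : ℤ → Prop) (w : ℤ → ℝ) (r : ℝ) (hr : 0 < r)
    (hw : ∀ x, 0 ≤ w x) (h1 : ∀ x, I x → 1 ≤ w x)
    (hs : ∀ x, p * w (x+1) + q * w (x-1) ≤ w x)
    (hI : ∀ x, I x → p * w (x+1) + q * w (x-1) ≤ r * w x) (n : ℕ) :
    ∀ (j : ℕ) (x : ℤ) (m : ℕ), P {ω | m < cntV X I j n x ω} ≤
      ENNReal.ofReal ((p * w (x+1) + q * w (x-1)) * r ^ m) := by
  classical
  obtain ⟨hm, hi, hP, hQ⟩ := hX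
  induction n with
  | zero => intro j x m; simp [cntV]
  | succ n ih =>
    intro j x m
    have hy : ∀ y : ℤ, P {ω | m < cntV X I (j+1) n y ω + (if I y then 1 else 0)} ≤
        ENNReal.ofReal (w y * r ^ m) := by
      intro y
      by_cases hIy : I y
      · simp only [hIy, if_true]
        cases m with
        | zero =>
          refine prob_le_one.trans ?_
          simpa using h1 y hIy
        | succ m =>
          simp only [add_lt_add_iff_right]
          refine (ih (j+1) y m).trans (ENNReal.ofReal_le_ofReal ?_)
          rw [pow_succ]
          nlinarith [hI y hIy, pow_pos hr m]
      · simp only [hIy, if_false, add_zero]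
        refine (ih (j+1) y m).trans (ENNReal.ofReal_le_ofReal ?_)
        exact mul_le_mul_of_nonneg_right (hs y) (pow_pos hr m).le
    have hae : ∀ᵐ ω ∂P, X j ω = 1 ∨ X j ω = -1 := by
      have hd : Disjoint {ω | X j ω = 1} {ω | X j ω = -1} := by
        rw [Set.disjoint_left]; intro ω h h'; simp only [Set.mem_ofPred_eq] at h h'; omega
      have hmeas : ∀ v : ℤ, MeasurableSet {ω | X j ω = v} := fun v =>
        hm j (measurableSet_singleton v)
      have : P ({ω | X j ω = 1} ∪ {ω | X j ω = -1}) = 1 := by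
        rw [measure_union hd (hmeas _), hP, hQ, ← ENNReal.ofReal_add hp0.le hq0.le, hpq]
        simp
      exact (prob_compl_eq_zero_iff ((hmeas 1).union (hmeas (-1)))).2 this
    have hst : ∀ v : ℤ, P ({ω | X j ω = v} ∩
        {ω | m < cntV X I (j+1) n (x+v) ω + (if I (x+v) then 1 else 0)}) ≤
        P {ω | X j ω = v} * ENNReal.ofReal (w (x+v) * r ^ m) := by
      intro v
      have := step_indep P X hm hi I j n (x+v) v {c | m < c + (if I (x+v) then 1 else 0)}
      have e : (cntV X I (j+1) n (x+v)) ⁻¹' {c | m < c + (if I (x+v) then 1 else 0)} =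
        {ω | m < cntV X I (j+1) n (x+v) ω + (if I (x+v) then 1 else 0)} := rfl
      rw [e] at this
      rw [this]
      gcongr
      exact hy _
    calc P {ω | m < cntV X I j (n+1) x ω}
        ≤ P (({ω | X j ω = 1} ∩ {ω | m < cntV X I (j+1) n (x+1) ω + (if I (x+1) then 1 else 0)}) ∪
           ({ω | X j ω = -1} ∩ {ω | m < cntV X I (j+1) n (x+(-1)) ω + (if I (x+(-1)) then 1 else 0)})) := by
          apply measure_mono_ae
          filter_upwards [hae] with ω hω h
          change m < _ at h
          rw [cntV_succ] at h
          rcases hω with h' | h'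
          · left; rw [h'] at h; exact ⟨h', h⟩
          · right; rw [h'] at h; exact ⟨h', h⟩
      _ ≤ _ := measure_union_le _ _
      _ ≤ _ := add_le_add (hst 1) (hst (-1))
      _ = _ := by
          rw [hP, hQ, ← ENNReal.ofReal_mul hp0.le, ← ENNReal.ofReal_mul hq0.le,
            ← ENNReal.ofReal_add]
          · congr 1; rw [sub_eq_add_neg]; ring
          · have := hw (x+1); positivity
          · have := hw (x+(-1)); positivity

lemma key_total [MeasurableSpace Ω] (P : Measure Ω) [IsProbabilityMeasure P]
    (X : ℕ → Ω → ℤ) (z : ℤ) (hz : 1 ≤ z) (m : ℕ) (c : ℝ≥0∞)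
    (h : ∀ n, P {ω | m < cntV X (fun y => y = 0 ∨ y = z) 0 n 0 ω} ≤ c) :
    P {ω | (m : ℕ∞) < totalLocalTime X 0 ω + totalLocalTime X z ω} ≤ c := by
  classical
  have hmono : Monotone (fun n => {ω | m < cntV X (fun y => y = 0 ∨ y = z) 0 n 0 ω}) := by
    intro a b hab ω hω
    change m < _ at hω
    change m < _
    refine lt_of_lt_of_le hω ?_
    exact Finset.sum_le_sum_of_subset (Finset.range_mono hab)
  have hsub : {ω | (m : ℕ∞) < totalLocalTime X 0 ω + totalLocalTime X z ω} ⊆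
      ⋃ n, {ω | m < cntV X (fun y => y = 0 ∨ y = z) 0 n 0 ω} := by
    intro ω hω
    simp only [Set.mem_ofPred_eq, totalLocalTime] at hω
    rw [← Set.encard_union_eq] at hω
    swap
    · rw [Set.disjoint_left]; intro k h h'; simp only [Set.mem_ofPred_eq] at h h'; omega
    obtain ⟨t, ht, hc⟩ := Set.exists_subset_encard_eq (Order.add_one_le_of_lt hω)
    have hfin : t.Finite := Set.finite_of_encard_eq_coe (k := m+1) (by simpa using hc)
    obtain ⟨N, hN⟩ := hfin.bddAbove
    simp only [Set.mem_iUnion]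
    refine ⟨N, ?_⟩
    simp only [Set.mem_ofPred_eq, cntV, zero_add]
    rw [← Finset.card_filter]
    have hcard : hfin.toFinset.card = m + 1 := by
      have := hfin.encard_eq_coe_toFinset_card
      rw [hc] at this
      exact_mod_cast this.symm
    have hle : (hfin.toFinset.image (fun k => k - 1)).card = hfin.toFinset.card := by
      apply Finset.card_image_of_injOn
      intro a ha b hb hab
      have ha' := ht ((hfin.mem_toFinset).1 ha)
      have hb' := ht ((hfin.mem_toFinset).1 hb)
      simp only [Set.mem_union, Set.mem_ofPred_eq] at ha' hb' hab
      omega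
    refine Nat.lt_of_succ_le ?_
    rw [Nat.succ_eq_add_one, ← hcard, ← hle]
    apply Finset.card_le_card
    intro k hk
    obtain ⟨a, ha, rfl⟩ := Finset.mem_image.1 hk
    have ha1 := (hfin.mem_toFinset).1 ha
    have ha' := ht ha1
    have haN := hN ha1
    simp only [Set.mem_union, Set.mem_ofPred_eq, S] at ha'
    have hpos : 0 < a := by omega
    have e : a - 1 + 1 = a := by omega
    rw [Finset.mem_filter, e, Finset.mem_range]
    refine ⟨by omega, ?_⟩
    tauto
  refine (measure_mono hsub).trans ?_
  rw [hmono.measure_iUnion]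
  exact iSup_le h

/-- The superharmonic weight. -/
noncomputable def wgt (h g : ℝ) (z : ℤ) (x : ℤ) : ℝ :=
  if x ≤ 0 then 1 + g * (1 - h ^ z) else if x ≤ z then 1 + g * (h ^ x - h ^ z) else h ^ (x - z)

lemma wgt_props (p q s r : ℝ) (hp0 : 0 < p) (hq0 : 0 < q) (hpq : p + q = 1) (hq : q < 1/2)
    (hs0 : 0 < s) (hs : s ^ 2 = q / p) (hr : r = (2*q + s) / (1+s)) (z : ℤ) (hz : 1 ≤ z) :
    ∃ w : ℤ → ℝ, (∀ x, 0 ≤ w x) ∧ (∀ x, (x = 0 ∨ x = z) → 1 ≤ w x) ∧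
    (∀ x, p * w (x+1) + q * w (x-1) ≤ w x) ∧
    (∀ x, (x = 0 ∨ x = z) → p * w (x+1) + q * w (x-1) ≤ r * w x) ∧ w 0 ≤ 1 + 1 / s := by
  obtain ⟨h, hh⟩ : ∃ h, h = s ^ 2 := ⟨_, rfl⟩
  have hh0 : 0 < h := by rw [hh]; positivity
  have hph : q = p * h := by rw [hh, hs]; field_simp
  have hh1 : h < 1 := by nlinarith
  have hs1 : s < 1 := by nlinarith
  have hr1 : r ≤ 1 := by rw [hr, div_le_one (by positivity)]; linarith
  obtain ⟨T, hT⟩ : ∃ T, T = h ^ z := ⟨_, rfl⟩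
  have hT0 : 0 < T := by rw [hT]; positivity
  have hTh : T ≤ h := by
    rw [hT]; simpa using zpow_le_zpow_right_of_le_one₀ hh0 hh1.le hz
  obtain ⟨g, hg⟩ : ∃ g, g = 1 / (s + T) := ⟨_, rfl⟩
  have hg0 : 0 < g := by rw [hg]; positivity
  have hg1 : g * (s + T) = 1 := by rw [hg]; field_simp
  have hgs : g ≤ 1 / s := by rw [hg]; gcongr; linarith
  have hanti : ∀ x, x ≤ z → T ≤ h ^ x := fun x hx => by
    rw [hT]; exact zpow_le_zpow_right_of_le_one₀ hh0 hh1.le hx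
  have w1 : ∀ x, x ≤ 0 → wgt h g z x = 1 + g * (1 - T) := fun x hx => by simp [wgt, hx, hT]
  have w2 : ∀ x, 0 ≤ x → x ≤ z → wgt h g z x = 1 + g * (h ^ x - T) := fun x hx hx' => by
    rcases hx.eq_or_lt with rfl | hx
    · simp [wgt, hT]
    · simp [wgt, not_le.2 hx, hx', hT]
  have w3 : ∀ x, z ≤ x → wgt h g z x = h ^ (x - z) := fun x hx => by
    rcases hx.eq_or_lt with rfl | hx
    · rw [w2 _ (by omega) le_rfl]; simp [hT]
    · simp [wgt, not_le.2 hx, show ¬ x ≤ 0 by omega]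
  have hnn : ∀ x, 0 ≤ wgt h g z x := fun x => by
    rcases le_total x z with hx | hx
    · rcases le_total x 0 with hx' | hx'
      · rw [w1 x hx']; nlinarith
      · rw [w2 x hx' hx]; nlinarith [hanti x hx]
    · rw [w3 x hx]; positivity
  have hrs : r * (1 + s) = 2*q + s := by rw [hr]; field_simp
  have hI0 : p * wgt h g z (0+1) + q * wgt h g z (0-1) ≤ r * wgt h g z 0 := by
    rw [w2 (0+1) (by omega) (by omega), w1 (0-1) (by omega), w1 0 le_rfl]
    have e1 : (0:ℤ) + 1 = 1 := rfl
    rw [e1, zpow_one]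
    have e2 : 1 + g * (1 - T) = g * (1 + s) := by linear_combination -hg1
    rw [e2, show r * (g * (1 + s)) = g * (r * (1 + s)) by ring, hrs]
    apply le_of_eq
    have e3 : 1 + g * (h - T) = g * (s + h) := by linear_combination -hg1
    rw [e3]
    linear_combination g * s * hpq - g * hph
  have hIz : p * wgt h g z (z+1) + q * wgt h g z (z-1) ≤ r * wgt h g z z := by
    rw [w3 (z+1) (by omega), w2 (z-1) (by omega) (by omega), w3 z le_rfl, zpow_sub_one₀ hh0.ne', ← hT]
    simp only [add_sub_cancel_left, zpow_one, sub_self, zpow_zero]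
    have e1 : q * (1 + g * (T * h⁻¹ - T)) = q + g * T * (p - q) := by
      rw [hph]; field_simp
    rw [e1, ← hph, mul_one]
    have e2 : g * T * (1 + s) ≤ s := by
      have : g * T ≤ g * h := by gcongr
      have e4 : s = g * s ^ 2 + s * (g * T) := by linear_combination -s * hg1
      rw [hh] at this
      linarith
    have e3 : (q + (q + g * T * (p - q))) * (1 + s) ≤ r * (1 + s) := by
      rw [hrs]
      have hp : p = 1 - q := by linarith
      rw [hp]
      nlinarith [mul_le_mul_of_nonneg_right e2 (show 0 ≤ 1 - 2*q by linarith)]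
    exact le_of_mul_le_mul_right e3 (by positivity)
  refine ⟨wgt h g z, hnn, ?_, ?_, ?_, ?_⟩
  · rintro x (rfl | rfl)
    · rw [w1 0 le_rfl]; nlinarith
    · rw [w3 _ le_rfl]; simp
  · intro x
    have harm : ∀ y : ℤ, p * h ^ (y+1) + q * h ^ (y-1) = h ^ y := fun y => by
      rw [zpow_add_one₀ hh0.ne', zpow_sub_one₀ hh0.ne', hph]
      have : p + p * h = 1 := by linarith
      field_simp
      linear_combination this
    rcases lt_trichotomy x 0 with hx | rfl | hx
    · rw [w1 _ (by omega), w1 _ (by omega), w1 _ (by omega), ← add_mul, hpq, one_mul]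
    · exact hI0.trans (mul_le_of_le_one_left (hnn 0) hr1)
    · rcases lt_trichotomy x z with hx' | rfl | hx'
      · rw [w2 _ (by omega) (by omega), w2 _ (by omega) (by omega), w2 _ (by omega) (by omega)]
        apply le_of_eq
        linear_combination g * harm x + (1 - g * T) * hpq
      · exact hIz.trans (mul_le_of_le_one_left (hnn _) hr1)
      · rw [w3 _ (by omega), w3 _ (by omega), w3 _ (by omega)]
        have := harm (x - z)
        rw [show x + 1 - z = x - z + 1 by ring, show x - 1 - z = x - z - 1 by ring]
        exact this.le
  · rintro x (rfl | rfl)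
    · exact hI0
    · exact hIz
  · rw [w1 0 le_rfl]; nlinarith

theorem two_point_total_local_time_tail
    [MeasurableSpace Ω] (P : Measure Ω) [IsProbabilityMeasure P]
    (X : ℕ → Ω → ℤ) (p q : ℝ) (hq0 : 0 < q) (hq : q < 1/2) (hpq : p + q = 1)
    (hX : IsAsymmetricSRW P X p q)
    (lam δ : ℝ) (hlam : lam = -1 / Real.log (2*q))
    (hδ : δ = 2 * Real.log ((2*q + Real.sqrt (q/p)) / (1 + Real.sqrt (q/p))) / Real.log (2*q) - 1)
    (A : ℝ) (hA : 0 < A) :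
    ∃ C : ℝ, 0 < C ∧ ∀ n : ℕ, 0 < n → ∀ z : ℤ, 1 ≤ z →
      P {ω | ENNReal.ofReal (2 * lam * A * Real.log n)
              < ((totalLocalTime X 0 ω + totalLocalTime X z ω : ℕ∞) : ℝ≥0∞)}
        ≤ ENNReal.ofReal (C * (n : ℝ) ^ (-(A * (1 + δ)))) := by
  have hp0 : 0 < p := by linarith
  obtain ⟨s, hs⟩ : ∃ s, s = Real.sqrt (q/p) := ⟨_, rfl⟩
  rw [← hs] at hδ
  have hs0 : 0 < s := by rw [hs]; positivity
  have hs2 : s ^ 2 = q / p := by rw [hs]; exact Real.sq_sqrt (by positivity)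
  obtain ⟨r, hr⟩ : ∃ r, r = (2*q + s) / (1+s) := ⟨_, rfl⟩
  rw [← hr] at hδ
  have hr0 : 0 < r := by rw [hr]; positivity
  have hr1 : r ≤ 1 := by rw [hr, div_le_one (by positivity)]; linarith
  have hlog : Real.log (2*q) < 0 := Real.log_neg (by linarith) (by linarith)
  have hlam0 : 0 < lam := by rw [hlam]; exact div_pos_of_neg_of_neg (by norm_num) hlog
  refine ⟨1 + 1/s, by positivity, fun n hn z hz => ?_⟩
  have hn1 : (1:ℝ) ≤ n := by exact_mod_cast hn
  have hn0 : (0:ℝ) < n := by linarith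
  obtain ⟨T, hT⟩ : ∃ T, T = 2 * lam * A * Real.log n := ⟨_, rfl⟩
  have hT0 : 0 ≤ T := by rw [hT]; have := Real.log_nonneg hn1; positivity
  rw [← hT]
  have hpow : (n : ℝ) ^ (-(A * (1 + δ))) = r ^ T := by
    rw [Real.rpow_def_of_pos hn0, Real.rpow_def_of_pos hr0, hT, hδ, hlam]
    congr 1
    field_simp
    ring
  rw [hpow]
  obtain ⟨w, hw, h1, hsup, hI, hw0⟩ := wgt_props p q s r hp0 hq0 hpq hq hs0 hs2 hr z hz
  have hk := key_bound P X p q hp0 hq0 hpq hX (fun y => y = 0 ∨ y = z) w r hr0 hw h1 hsup hI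
  have hmain := key_total P X z hz ⌊T⌋₊ _ (fun n => hk n 0 0 ⌊T⌋₊)
  refine (measure_mono ?_).trans (hmain.trans (ENNReal.ofReal_le_ofReal ?_))
  · intro ω hω
    simp only [Set.mem_ofPred_eq] at hω ⊢
    have : ((⌊T⌋₊ : ℕ∞) : ℝ≥0∞) ≤ ENNReal.ofReal T := by
      rw [ENat.toENNReal_coe, ← ENNReal.ofReal_natCast]
      exact ENNReal.ofReal_le_ofReal (Nat.floor_le hT0)
    exact ENat.toENNReal_lt.1 (this.trans_lt hω)
  · have e1 : r * r ^ ⌊T⌋₊ ≤ r ^ T := by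
      rw [← pow_succ', ← Real.rpow_natCast]
      apply Real.rpow_le_rpow_of_exponent_ge hr0 hr1
      push_cast
      exact (Nat.lt_floor_add_one T).le
    calc _ ≤ (r * w 0) * r ^ ⌊T⌋₊ := by
          have := hI 0 (Or.inl rfl)
          gcongr
      _ = w 0 * (r * r ^ ⌊T⌋₊) := by ring
      _ ≤ (1 + 1/s) * r ^ T := by gcongr
end

section
/- Let A_1, ..., A_n be events on a probability space all having the same probability P(A_j) = c > 0. Then for every integer k with 1 ≤ k ≤ n - 1, P(Σ_{j=1}^n 1_{A_j} > k) ≥ c - k(k+1)/(2n). -/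
open MeasureTheory Filter Set
open scoped ENNReal NNReal

/-- If `A_1, …, A_n` are events all of probability `c > 0`, then for every
`1 ≤ k ≤ n - 1`, `P(Σ_{j=1}^n 1_{A_j} > k) ≥ c - k(k+1)/(2n)`. -/
theorem prob_many_events
    {Ω : Type*} [MeasurableSpace Ω] (P : Measure Ω) [IsProbabilityMeasure P]
    (n : ℕ) (A : Fin n → Set Ω) (hA : ∀ j, MeasurableSet (A j))
    (c : ℝ) (hc0 : 0 < c) (hc1 : c ≤ 1) (hAc : ∀ j, P (A j) = ENNReal.ofReal c)
    (k : ℕ) (hk1 : 1 ≤ k) (hkn : k ≤ n - 1) :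
    ENNReal.ofReal (c - k * (k + 1) / (2 * n))
      ≤ P {ω | (k : ℝ) < ∑ j : Fin n, (A j).indicator (fun _ => (1 : ℝ)) ω} := by
  classical
  set S : Ω → ℝ := fun ω => ∑ j : Fin n, (A j).indicator (fun _ => (1 : ℝ)) ω with hS
  have hn : (0 : ℝ) < n := by
    have : 0 < n := by omega
    exact_mod_cast this
  have hSm : Measurable S := Finset.measurable_sum _ fun j _ => measurable_const.indicator (hA j)
  set B : Set Ω := {ω | (k : ℝ) < S ω} with hB
  have hBm : MeasurableSet B := measurableSet_lt measurable_const hSm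
  have hint : ∀ j, Integrable ((A j).indicator (fun _ => (1 : ℝ))) P :=
    fun j => (integrable_const _).indicator (hA j)
  have hSint : Integrable S P := integrable_finsetSum _ fun j _ => hint j
  have hES : ∫ ω, S ω ∂P = n * c := by
    rw [hS, integral_finsetSum _ fun j _ => hint j]
    have : ∀ j, ∫ ω, (A j).indicator (fun _ => (1 : ℝ)) ω ∂P = c := by
      intro j
      rw [integral_indicator_const _ (hA j), measureReal_def, hAc j,
        ENNReal.toReal_ofReal hc0.le]
      simp
    simp [this]
  have hBint : Integrable (B.indicator (fun _ => (n : ℝ))) P := (integrable_const _).indicator hBm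
  have hle : ∀ ω, S ω ≤ B.indicator (fun _ => (n : ℝ)) ω + k := by
    intro ω
    by_cases h : ω ∈ B
    · rw [indicator_of_mem h]
      have h1 : S ω ≤ ∑ j : Fin n, (1 : ℝ) :=
        Finset.sum_le_sum fun j _ => indicator_le_self' (fun _ _ => zero_le_one) ω
      have h2 : (∑ j : Fin n, (1 : ℝ)) = n := by simp
      have h3 : (0 : ℝ) ≤ k := Nat.cast_nonneg k
      linarith
    · rw [indicator_of_notMem h]
      have : ¬ ((k : ℝ) < S ω) := h
      linarith
  have hmono : ∫ ω, S ω ∂P ≤ ∫ ω, (B.indicator (fun _ => (n : ℝ)) ω + k) ∂P :=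
    integral_mono hSint (hBint.add (integrable_const _)) hle
  rw [hES, integral_add hBint (integrable_const _), integral_indicator_const _ hBm] at hmono
  simp only [integral_const, probReal_univ, smul_eq_mul, one_mul] at hmono
  refine ENNReal.ofReal_le_of_le_toReal ?_
  change _ ≤ P.real B
  have hk : (1 : ℝ) ≤ k := by exact_mod_cast hk1
  rw [sub_le_iff_le_add, ← sub_le_iff_le_add', le_div_iff₀ (by positivity)]
  nlinarith
end

section
/- For every ε ∈ (0,1) there exists a constant C > 0 such that for all sufficiently large n, P(ξ(n) ≥ 2(1 + ε/2) λ log n) ≤ C n^{-(1+ε)}. -/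
open MeasureTheory ProbabilityTheory Filter Set
open scoped ENNReal NNReal

variable {Ω : Type*}

/-- number of visits to `0` at times `0..N` of the walk from `y` with steps `s`. -/
def cnt : ℕ → ℤ → (ℕ → ℤ) → ℕ
  | 0, y, _ => if y = 0 then 1 else 0
  | N + 1, y, s => (if y = 0 then 1 else 0) + cnt N (y + s 0) (fun i => s (i + 1))

lemma cnt_eq (N : ℕ) : ∀ (y : ℤ) (s : ℕ → ℤ),
    cnt N y s = ((Finset.range (N + 1)).filter
      (fun k => y + ∑ i ∈ Finset.range k, s i = 0)).card := by
  induction N with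
  | zero => intro y s; simp [cnt, Finset.filter_singleton]; split_ifs <;> simp
  | succ N ih =>
    intro y s
    rw [cnt, ih, Finset.card_filter, Finset.card_filter, Finset.sum_range_succ' _ (N + 1),
      add_comm]
    congr 1
    · apply Finset.sum_congr rfl
      intro k _
      rw [Finset.sum_range_succ' _ k]
      congr 1
      rw [add_assoc, add_comm (s 0)]
    · simp

lemma measurable_cnt (N : ℕ) (y : ℤ) : Measurable (cnt N y) := by
  have : cnt N y = fun s => ∑ k ∈ Finset.range (N + 1),
      if y + ∑ i ∈ Finset.range k, s i = 0 then 1 else 0 := by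
    funext s; rw [cnt_eq, Finset.card_filter]
  rw [this]
  refine Finset.measurable_sum _ fun k _ => ?_
  refine Measurable.ite ?_ measurable_const measurable_const
  have hm : Measurable (fun s : ℕ → ℤ => y + ∑ i ∈ Finset.range k, s i) := by fun_prop
  exact hm (measurableSet_singleton 0)

noncomputable def hit (ρ : ℝ) (y : ℤ) : ℝ := if y ≤ 0 then 1 else ρ ^ y

noncomputable def V (q ρ : ℝ) (y : ℤ) : ℕ → ℝ
  | 0 => 1
  | r + 1 => hit ρ y * (2 * q) ^ r

lemma indep_future [MeasurableSpace Ω] (P : Measure Ω) 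
    (X : ℕ → Ω → ℤ) (hm : ∀ i, Measurable (X i)) (hi : iIndepFun X P) (j : ℕ) :
    IndepFun (X j) (fun ω i => X (j + 1 + i) ω) P := by
  have h := indep_iSup_of_disjoint (m := fun i => MeasurableSpace.comap (X i) inferInstance)
    (fun i => (hm i).comap_le) hi (S := {j}) (T := Set.Ioi j) (by simp)
  rw [IndepFun_iff_Indep]
  refine indep_of_indep_of_le_left (indep_of_indep_of_le_right h ?_) ?_
  · rw [← measurable_iff_comap_le]
    refine @measurable_pi_lambda _ _ _ (_) _ _ fun i => ?_
    rw [measurable_iff_comap_le]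
    exact le_iSup₂_of_le (j + 1 + i) (by simp; omega) le_rfl
  · exact le_iSup₂_of_le j (by simp) le_rfl

lemma cnt_bound [MeasurableSpace Ω] (P : Measure Ω) [IsProbabilityMeasure P]
    (X : ℕ → Ω → ℤ) (p q : ℝ) (hq0 : 0 < q) (hq : q < 1/2) (hpq : p + q = 1)
    (hX : IsAsymmetricSRW P X p q) (N : ℕ) : ∀ (j : ℕ) (y : ℤ) (r : ℕ),
    P.real {ω | r ≤ cnt N y (fun i => X (j + i) ω)} ≤ V q (q / p) y r := by
  obtain ⟨hm, hi, h1, h2⟩ := hX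
  have hp0 : 0 < p := by linarith
  have hρ : 0 < q / p := by positivity
  have hhit : ∀ y, 0 ≤ hit (q / p) y := by
    intro y; unfold hit; split_ifs <;> positivity
  induction N with
  | zero =>
    intro j y r
    match r with
    | 0 => simpa [V] using measureReal_le_one
    | 1 =>
      by_cases hy : y = 0
      · subst hy; simpa [V, hit] using measureReal_le_one
      · simpa [V, cnt, hy] using hhit y
    | r + 2 =>
      have : {ω | r + 2 ≤ cnt 0 y (fun i => X (j + i) ω)} = ∅ := by
        ext ω; simp only [cnt]; split_ifs <;> simp
      rw [this]
      have := hhit y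
      simp only [measureReal_empty, V]
      positivity
  | succ N ih =>
    intro j y r
    have step : ∀ r', P.real {ω | r' ≤ cnt N (y + X j ω) (fun i => X (j + 1 + i) ω)} ≤
        p * V q (q / p) (y + 1) r' + q * V q (q / p) (y - 1) r' := by
      intro r'
      have part : ∀ a : ℤ, ∀ c : ℝ, 0 ≤ c → P {ω | X j ω = a} = ENNReal.ofReal c →
          P.real ({ω | X j ω = a} ∩ {ω | r' ≤ cnt N (y + a) (fun i => X (j + 1 + i) ω)})
            ≤ c * V q (q / p) (y + a) r' := by
        intro a c hc ha
        have hind := (indep_future P X hm hi j).measure_inter_preimage_eq_mul {a}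
          {s | r' ≤ cnt N (y + a) s} (measurableSet_singleton a)
          (measurableSet_le measurable_const (measurable_cnt N (y + a)))
        have : P.real ({ω | X j ω = a} ∩ {ω | r' ≤ cnt N (y + a) (fun i => X (j + 1 + i) ω)})
            = P.real {ω | X j ω = a} *
              P.real {ω | r' ≤ cnt N (y + a) (fun i => X (j + 1 + i) ω)} := by
          simp only [Measure.real]
          rw [← ENNReal.toReal_mul]
          exact congrArg _ hind
        rw [this]
        have hc' : P.real {ω | X j ω = a} = c := by
          rw [Measure.real, ha, ENNReal.toReal_ofReal hc]
        rw [hc']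
        exact mul_le_mul_of_nonneg_left (ih _ _ _) hc
      have hme : ∀ a : ℤ, MeasurableSet {ω | X j ω = a} := fun a =>
        hm j (measurableSet_singleton a)
      have hrest : P.real ({ω | X j ω = 1} ∪ {ω | X j ω = -1})ᶜ = 0 := by
        rw [probReal_compl_eq_one_sub ((hme 1).union (hme (-1))), measureReal_union _ (hme _)]
        · simp only [Measure.real]
          rw [h1, h2, ENNReal.toReal_ofReal hp0.le, ENNReal.toReal_ofReal hq0.le, hpq, sub_self]
        · rw [Set.disjoint_left]; intro ω ha hb
          simp only [Set.mem_setOf_eq] at ha hb; omega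
      have hsub : {ω | r' ≤ cnt N (y + X j ω) (fun i => X (j + 1 + i) ω)} ⊆
          (({ω | X j ω = 1} ∩ {ω | r' ≤ cnt N (y + 1) (fun i => X (j + 1 + i) ω)}) ∪
          ({ω | X j ω = -1} ∩ {ω | r' ≤ cnt N (y + -1) (fun i => X (j + 1 + i) ω)})) ∪
          ({ω | X j ω = 1} ∪ {ω | X j ω = -1})ᶜ := by
        intro ω hω
        simp only [Set.mem_setOf_eq] at hω
        by_cases ha : X j ω = 1
        · left; left; exact ⟨ha, by simpa [ha] using hω⟩
        by_cases hb : X j ω = -1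
        · left; right; exact ⟨hb, by simpa [hb] using hω⟩
        right
        simp [ha, hb]
      have e1 := measureReal_mono (μ := P) hsub
      have e2 := measureReal_union_le (μ := P)
        (({ω | X j ω = 1} ∩ {ω | r' ≤ cnt N (y + 1) (fun i => X (j + 1 + i) ω)}) ∪
          ({ω | X j ω = -1} ∩ {ω | r' ≤ cnt N (y + -1) (fun i => X (j + 1 + i) ω)}))
          ({ω | X j ω = 1} ∪ {ω | X j ω = -1})ᶜ
      have e3 := measureReal_union_le (μ := P)
        ({ω | X j ω = 1} ∩ {ω | r' ≤ cnt N (y + 1) (fun i => X (j + 1 + i) ω)})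
          ({ω | X j ω = -1} ∩ {ω | r' ≤ cnt N (y + -1) (fun i => X (j + 1 + i) ω)})
      have e4 := part 1 p hp0.le (h1 j)
      have e5 := part (-1) q hq0.le (h2 j)
      rw [← sub_eq_add_neg] at e5
      rw [← sub_eq_add_neg] at e1 e2 e3
      linarith
    have hcnt : ∀ ω, cnt (N + 1) y (fun i => X (j + i) ω) =
        (if y = 0 then 1 else 0) + cnt N (y + X j ω) (fun i => X (j + 1 + i) ω) := by
      intro ω
      simp only [cnt, add_zero]
      congr 3
      funext i
      rw [add_assoc, add_comm 1 i]
    simp only [hcnt]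
    match r with
    | 0 => simpa [V] using measureReal_le_one
    | r + 1 =>
      by_cases hy : y = 0
      · subst hy
        match r with
        | 0 => simpa [V, hit] using measureReal_le_one
        | r + 1 =>
          have : ∀ ω, (r + 1 + 1 ≤ (if (0:ℤ) = 0 then 1 else 0) +
              cnt N (0 + X j ω) (fun i => X (j + 1 + i) ω)) ↔
              (r + 1 ≤ cnt N (0 + X j ω) (fun i => X (j + 1 + i) ω)) := by
            intro ω; simp only [if_true]; omega
          rw [show {ω | r + 1 + 1 ≤ (if (0:ℤ) = 0 then 1 else 0) +
              cnt N (0 + X j ω) (fun i => X (j + 1 + i) ω)} =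
              {ω | r + 1 ≤ cnt N (0 + X j ω) (fun i => X (j + 1 + i) ω)} from Set.ext this]
          refine (step (r + 1)).trans (le_of_eq ?_)
          simp [V, hit]
          field_simp
          ring
      · simp only [hy, if_false, zero_add]
        refine (step (r + 1)).trans ?_
        simp only [V]
        have hk : p * hit (q / p) (y + 1) + q * hit (q / p) (y - 1) ≤ hit (q / p) y := by
          rcases lt_or_gt_of_ne hy with h | h
          · rw [hit, hit, hit, if_pos (by omega), if_pos (by omega), if_pos (by omega)]
            linarith
          · have hh : hit (q / p) (y - 1) = (q / p) ^ (y - 1) := by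
              rw [hit]; split_ifs with h'
              · have : y - 1 = 0 := by omega
                simp [this]
              · rfl
            rw [hh, hit, hit, if_neg (by omega), if_neg (by omega),
              zpow_add_one₀ hρ.ne', zpow_sub_one₀ hρ.ne']
            apply le_of_eq
            have : p * ((q / p) ^ y * (q / p)) + q * ((q / p) ^ y * (q / p)⁻¹)
              = (q / p) ^ y * (p + q) := by field_simp; ring
            rw [this, hpq, mul_one]
        calc _ = (p * hit (q / p) (y + 1) + q * hit (q / p) (y - 1)) * (2 * q) ^ r := by ring
          _ ≤ _ := mul_le_mul_of_nonneg_right hk (by positivity)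

lemma exists_cnt (X : ℕ → Ω → ℤ) (n m : ℕ) (hm : 1 ≤ m) (ω : Ω)
    (h : m ≤ maxLocalTime X n ω) :
    ∃ j ∈ Finset.Icc 1 n, m ≤ cnt n 0 (fun i => X (j + i) ω) := by
  have hmem : maxLocalTime X n ω ∈ Set.range fun z : ℤ => localTime X z n ω := by
    apply Nat.sSup_mem (Set.range_nonempty _)
    refine ⟨n, ?_⟩
    rintro _ ⟨z, rfl⟩
    exact (Finset.card_filter_le _ _).trans (by simp)
  obtain ⟨z, hz⟩ := hmem
  simp only at hz
  rw [← hz, localTime] at h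
  set F := (Finset.Icc 1 n).filter (fun k => S X k ω = z) with hF
  have hne : F.Nonempty := Finset.card_pos.mp (by omega)
  have hj := F.min'_mem hne
  set j := F.min' hne with hjdef
  have hj' := hj
  rw [hF, Finset.mem_filter] at hj'
  refine ⟨j, hj'.1, h.trans ?_⟩
  rw [cnt_eq]
  apply Finset.card_le_card_of_injOn (fun k => k - j)
  · intro k hk
    have hjk : j ≤ k := F.min'_le k hk
    have hk' : k ∈ F := hk
    rw [hF, Finset.mem_filter, Finset.mem_Icc] at hk'
    have h3 := Finset.sum_range_add (fun i => X i ω) j (k - j)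
    rw [Nat.add_sub_cancel' hjk] at h3
    have h4 := hk'.2
    have h5 := hj'.2
    unfold S at h4 h5
    simp only [Finset.coe_filter, Set.mem_setOf_eq, Finset.mem_range, zero_add]
    refine ⟨by omega, by omega⟩
  · intro a ha b hb hab
    have := F.min'_le a ha
    have := F.min'_le b hb
    simp only at hab
    omega

/-- For every `ε ∈ (0,1)` there is a constant `C > 0` such that for all large `n`,
`P(ξ(n) ≥ 2(1+ε/2) λ log n) ≤ C n^{-(1+ε)}`. -/
theorem maxLocalTime_upper_tail
    [MeasurableSpace Ω] (P : Measure Ω) [IsProbabilityMeasure P]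
    (X : ℕ → Ω → ℤ) (p q : ℝ) (hq0 : 0 < q) (hq : q < 1/2) (hpq : p + q = 1)
    (hX : IsAsymmetricSRW P X p q)
    (lam : ℝ) (hlam : lam = -1 / Real.log (2*q))
    (ε : ℝ) (hε : ε ∈ Set.Ioo (0:ℝ) 1) :
    ∃ C : ℝ, 0 < C ∧ ∃ N : ℕ, ∀ n : ℕ, N ≤ n →
      P {ω | 2 * (1 + ε/2) * lam * Real.log n ≤ (maxLocalTime X n ω : ℝ)}
        ≤ ENNReal.ofReal (C * (n : ℝ) ^ (-(1 + ε))) := by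
  have hlog : Real.log (2 * q) < 0 := Real.log_neg (by linarith) (by linarith)
  have hlam0 : 0 < lam := by
    rw [hlam]; exact div_pos_of_neg_of_neg (by norm_num) hlog
  refine ⟨1 / (2 * q), by positivity, 2, fun n hn => ?_⟩
  have hn1 : (1 : ℝ) < n := by exact_mod_cast hn
  have hn0 : (0 : ℝ) < n := by linarith
  have hε0 := hε.1
  have hlogn : 0 < Real.log n := Real.log_pos hn1
  set t := 2 * (1 + ε/2) * lam * Real.log n with ht
  have ht0 : 0 < t := by positivity
  obtain ⟨r, hr⟩ : ∃ r, ⌈t⌉₊ = r + 1 := Nat.exists_eq_succ_of_ne_zero (Nat.ceil_pos.mpr ht0).ne'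
  have hsub : {ω | t ≤ (maxLocalTime X n ω : ℝ)} ⊆
      ⋃ j ∈ Finset.Icc 1 n, {ω | r + 1 ≤ cnt n 0 (fun i => X (j + i) ω)} := by
    intro ω hω
    have h1 : r + 1 ≤ maxLocalTime X n ω := by rw [← hr]; exact Nat.ceil_le.mpr hω
    obtain ⟨j, hj, h⟩ := exists_cnt X n (r + 1) (by omega) ω h1
    simp only [Set.mem_iUnion]
    exact ⟨j, hj, h⟩
  rw [← ofReal_measureReal]
  apply ENNReal.ofReal_le_ofReal
  refine (measureReal_mono hsub (measure_ne_top _ _)).trans ((measureReal_biUnion_finset_le _ _).trans ?_)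
  refine (Finset.sum_le_sum fun j _ =>
    cnt_bound P X p q hq0 hq hpq hX n j 0 (r + 1)).trans ?_
  simp only [V, hit, le_refl, if_true, Finset.sum_const, Nat.card_Icc, nsmul_eq_mul, one_mul,
    Nat.add_sub_cancel]
  have hpow : (2 * q) ^ (r + 1) ≤ (n : ℝ) ^ (-(2 + ε)) := by
    have h1 : (2 * q) ^ (r + 1) ≤ (2 * q) ^ t := by
      rw [← Real.rpow_natCast]
      apply Real.rpow_le_rpow_of_exponent_ge (by positivity) (by linarith)
      rw [← hr]; exact Nat.le_ceil t
    refine h1.trans (le_of_eq ?_)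
    rw [Real.rpow_def_of_pos (by positivity), Real.rpow_def_of_pos hn0, ht, hlam]
    congr 1
    have := hlog.ne
    field_simp
  have hfin : (n : ℝ) ^ (-(1 + ε)) = n * (n : ℝ) ^ (-(2 + ε)) := by
    rw [show -(1 + ε) = 1 + -(2 + ε) by ring, Real.rpow_add hn0, Real.rpow_one]
  rw [hfin]
  calc (n : ℝ) * (2 * q) ^ r = 1 / (2 * q) * (n * (2 * q) ^ (r + 1)) := by
        rw [pow_succ]; field_simp
    _ ≤ _ := by gcongr
end
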